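/- arXiv:1412.3960 — 2 statements merged into one kernel-verified Lean document; each statement's English description precedes it below -/
import Mathlib

section
/- Let d ≥ 3 and let L ≥ 1, K ≥ 100 be integers. Set D = D_0, U = U_0 = ℤ^d ∩ [−KL+1,KL−1)^d and Ď = Ď_0 = ℤ^d ∩ [−4L,5L)^d, and let p = inf_{x∈∂U} P_x[H_D = ∞]. Then for every λ > 0 such that e^λ·(1−p) < 1, one has E_{ē_Ď}[e^{λ·N_{D,U}}] ≤ 1 + (cap(D)/cap(Ď))·(e^λ − 1)/(1 − e^λ·(1−p)), where N_{D,U} is the number of excursions of the walk from D to the complement of U. -/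
open MeasureTheory ENNReal Set
open scoped Classical NNReal

namespace Disconnection

/-- Points of `ℤ^d`. -/
abbrev Zd (d : ℕ) := Fin d → ℤ

/-- Step distribution of the simple random walk: uniform weight `1/(2d)` on each of the
`2d` unit vectors of `ℤ^d`. -/
noncomputable def stepP (d : ℕ) (v : Zd d) : ℝ≥0∞ :=
  if (∑ i, (v i).natAbs) = 1 then ((2 * d : ℕ) : ℝ≥0∞)⁻¹ else 0

/-- The exponential distribution of rate `1` on `[0,∞)` (as a measure on `ℝ`). -/
noncomputable def expMeasure : Measure ℝ :=
  MeasureTheory.volume.withDensity fun t => ENNReal.ofReal (if 0 < t then Real.exp (-t) else 0)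

/-- Nearest neighbours in `ℤ^d` (Euclidean distance one). -/
def adjacent {d : ℕ} (x y : Zd d) : Prop := (∑ i, (x i - y i).natAbs) = 1

/-- (Outer) boundary `∂A` of a set `A ⊆ ℤ^d`. -/
def bdry {d : ℕ} (A : Set (Zd d)) : Set (Zd d) := {y | y ∉ A ∧ ∃ x ∈ A, adjacent x y}

/-- sup-norm distance between two points of `ℤ^d`. -/
def supDist {d : ℕ} (x y : Zd d) : ℕ := Finset.univ.sup fun i => (x i - y i).natAbs

/-- closed sup-norm ball `B(x,r)` in `ℤ^d`. -/
def ball {d : ℕ} (x : Zd d) (r : ℕ) : Set (Zd d) := {y | supDist x y ≤ r}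

/-- mutual sup-norm distance between two sets. -/
noncomputable def setDist {d : ℕ} (A B : Set (Zd d)) : ℕ := sInf {n | ∃ x ∈ A, ∃ y ∈ B, supDist x y = n}

/-- the box `ℤ^d ∩ [a,b)^d`. -/
def intBox {d : ℕ} (a b : ℤ) : Set (Zd d) := {y | ∀ i, a ≤ y i ∧ y i < b}

/-- A box in `ℤ^d`: a translate of `[0,L)^d ∩ ℤ^d` with `L ≥ 1`. -/
def isBox {d : ℕ} (S : Set (Zd d)) : Prop :=
  ∃ L : ℕ, 1 ≤ L ∧ ∃ a : Zd d, S = {y | ∀ i, a i ≤ y i ∧ y i < a i + L}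

/-- connectedness of a subset of `ℤ^d` by nearest-neighbour paths. -/
def connSet {d : ℕ} (S : Set (Zd d)) : Prop :=
  ∀ a ∈ S, ∀ b ∈ S, ∃ (n : ℕ) (f : ℕ → Zd d), f 0 = a ∧ f n = b ∧
    (∀ k ≤ n, f k ∈ S) ∧ ∀ k < n, adjacent (f k) (f (k + 1))

/-- Euclidean norm of a lattice point. -/
noncomputable def eucNorm {d : ℕ} (x : Zd d) : ℝ := Real.sqrt (∑ i, ((x i : ℝ)) ^ 2)

/-- A model of the continuous-time simple random walk on `ℤ^d` with unit jump rate: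
`Y` is the discrete jump chain and `ζ` are the holding times; under `P x` one has
`Y 0 = x` a.s., and the increments of `Y` together with the holding times are mutually
independent, the increments uniform on the `2d` unit vectors and the holding times
exponential of rate `1`.  This is expressed through the finite-dimensional cylinder
probabilities, which determine the joint law. -/
structure SRW (d : ℕ) (Ω : Type*) [MeasurableSpace Ω] where
  P : Zd d → Measure Ω
  isProb : ∀ x, IsProbabilityMeasure (P x)
  Y : ℕ → Ω → Zd d
  ζ : ℕ → Ω → ℝ
  measurable_Y : ∀ n, Measurable (Y n)
  measurable_ζ : ∀ n, Measurable (ζ n)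
  Y_zero : ∀ x : Zd d, P x {ω | Y 0 ω = x} = 1
  law : ∀ (x : Zd d) (n : ℕ) (s : Fin n → Zd d) (I : Fin n → Set ℝ),
    (∀ i, MeasurableSet (I i)) →
    P x {ω | (∀ i : Fin n, Y ((i : ℕ) + 1) ω - Y (i : ℕ) ω = s i) ∧
             (∀ i : Fin n, ζ (i : ℕ) ω ∈ I i)}
      = (∏ i, stepP d (s i)) * ∏ i, expMeasure (I i)

namespace SRW

variable {d : ℕ} {Ω : Type*} [MeasurableSpace Ω]

/-- time of the `n`-th jump. -/
noncomputable def S (W : SRW d Ω) (n : ℕ) (ω : Ω) : ℝ := ∑ i ∈ Finset.range n, W.ζ i ω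

/-- index of the current step of the jump chain at time `t`. -/
noncomputable def jumpIdx (W : SRW d Ω) (t : ℝ) (ω : Ω) : ℕ := sSup {k : ℕ | W.S k ω ≤ t}

/-- the continuous-time walk `X_t`. -/
noncomputable def X (W : SRW d Ω) (t : ℝ) (ω : Ω) : Zd d := W.Y (W.jumpIdx t ω) ω

/-- entrance time of `A` after time `t` (`∞` if there is none). -/
noncomputable def hitFrom (W : SRW d Ω) (A : Set (Zd d)) (t : ℝ≥0∞) (ω : Ω) : ℝ≥0∞ :=
  sInf {u : ℝ≥0∞ | ∃ s : ℝ≥0, u = (s : ℝ≥0∞) ∧ t ≤ u ∧ W.X (s : ℝ) ω ∈ A}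

/-- entrance time `H_A = inf {t ≥ 0 : X_t ∈ A}`. -/
noncomputable def hit (W : SRW d Ω) (A : Set (Zd d)) (ω : Ω) : ℝ≥0∞ := W.hitFrom A 0 ω

/-- exit time `T_U = inf {t ≥ 0 : X_t ∉ U}`. -/
noncomputable def exit (W : SRW d Ω) (U : Set (Zd d)) (ω : Ω) : ℝ≥0∞ := W.hit Uᶜ ω

/-- hitting time `H̃_A = inf {t ≥ ζ₀ : X_t ∈ A}`. -/
noncomputable def hitTilde (W : SRW d Ω) (A : Set (Zd d)) (ω : Ω) : ℝ≥0∞ :=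
  W.hitFrom A (ENNReal.ofReal (W.ζ 0 ω)) ω

/-- the walk evaluated at a random (possibly infinite) time. -/
noncomputable def Xat (W : SRW d Ω) (τ : Ω → ℝ≥0∞) (ω : Ω) : Zd d := W.X (τ ω).toReal ω

/-- equilibrium measure `e_A(x) = P_x[H̃_A = ∞] 1_A(x)`. -/
noncomputable def eqm (W : SRW d Ω) (A : Set (Zd d)) (x : Zd d) : ℝ :=
  if x ∈ A then (W.P x {ω | W.hitTilde A ω = ⊤}).toReal else 0

/-- capacity `cap(A) = Σ_x e_A(x)`. -/
noncomputable def cap (W : SRW d Ω) (A : Set (Zd d)) : ℝ := ∑ᶠ x, W.eqm A x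

/-- normalized equilibrium measure `ē_A = e_A / cap(A)`. -/
noncomputable def ebar (W : SRW d Ω) (A : Set (Zd d)) (x : Zd d) : ℝ := W.eqm A x / W.cap A

/-- equilibrium measure of `A` relative to `U`: `e_{A,U}(x) = P_x[H̃_A > T_U] 1_A(x)`. -/
noncomputable def eqmRel (W : SRW d Ω) (A U : Set (Zd d)) (x : Zd d) : ℝ :=
  if x ∈ A then (W.P x {ω | W.exit U ω < W.hitTilde A ω}).toReal else 0

/-- `P_ρ = Σ_x ρ(x) P_x`, the walk started from the initial (sub-)measure with density `ρ`. -/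
noncomputable def Pinit (W : SRW d Ω) (ρ : Zd d → ℝ) : Measure Ω :=
  Measure.sum fun x : Zd d => ENNReal.ofReal (ρ x) • W.P x

/-- Green function `g(x,y) = E_x[∫₀^∞ 1{X_s = y} ds]`. -/
noncomputable def green (W : SRW d Ω) (x y : Zd d) : ℝ :=
  ∫ ω, (∫ s in Set.Ioi (0 : ℝ), if W.X s ω = y then (1 : ℝ) else 0) ∂ W.P x

/-- killed Green function `g_U(x,y) = E_x[∫₀^{T_U} 1{X_s = y} ds]`. -/
noncomputable def greenK (W : SRW d Ω) (U : Set (Zd d)) (x y : Zd d) : ℝ :=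
  ∫ ω, (∫ s in Set.Ioi (0 : ℝ),
      if ENNReal.ofReal s < W.exit U ω ∧ W.X s ω = y then (1 : ℝ) else 0) ∂ W.P x

/-- the potential operator `Gf(x) = Σ_y g(x,y) f(y)`. -/
noncomputable def Gop (W : SRW d Ω) (f : Zd d → ℝ) (x : Zd d) : ℝ :=
  ∑ᶠ y, W.green x y * f y

/-- successive return times to `A` (between excursions out of `U`): `Rt A U 0 = R₁ = H_A`. -/
noncomputable def Rt (W : SRW d Ω) (A U : Set (Zd d)) : ℕ → Ω → ℝ≥0∞
  | 0 => W.hit A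
  | k + 1 => fun ω => W.hitFrom A (W.hitFrom Uᶜ (W.Rt A U k ω) ω) ω

/-- successive departure times from `U`: `Dt A U k = D_{k+1}`. -/
noncomputable def Dt (W : SRW d Ω) (A U : Set (Zd d)) (k : ℕ) (ω : Ω) : ℝ≥0∞ :=
  W.hitFrom Uᶜ (W.Rt A U k ω) ω

/-- number of excursions from `A` to the complement of `U`:
`N_{A,U} = sup {k ≥ 1 : D_k < ∞}` (with `sup ∅ = 0`). -/
noncomputable def Nexc (W : SRW d Ω) (A U : Set (Zd d)) (ω : Ω) : ℕ :=
  sSup {n | 0 < n ∧ W.Dt A U (n - 1) ω < ⊤}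

end SRW

end Disconnection

open Disconnection

namespace Disconnection
section helper

lemma unique_law {X : Type*} [MeasurableSpace X] [Countable X] [MeasurableSingletonClass X]
    (ν₁ ν₂ : Measure (ℕ → X)) [IsFiniteMeasure ν₁] [IsFiniteMeasure ν₂]
    (h : ∀ (n : ℕ) (a : ℕ → X), ν₁ {w | ∀ i ≤ n, w i = a i} = ν₂ {w | ∀ i ≤ n, w i = a i}) :
    ν₁ = ν₂ := by
  have key : ∀ n : ℕ, ν₁.map (fun (w : ℕ → X) (i : Fin (n+1)) => w i)
      = ν₂.map (fun (w : ℕ → X) (i : Fin (n+1)) => w i) := by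
    intro n
    have hm : Measurable (fun (w : ℕ → X) (i : Fin (n+1)) => w i) := by fun_prop
    refine Measure.ext_of_singleton fun t => ?_
    rw [Measure.map_apply hm (measurableSet_singleton _),
      Measure.map_apply hm (measurableSet_singleton _)]
    have : (fun (w : ℕ → X) (i : Fin (n+1)) => w i) ⁻¹' {t}
      = {w | ∀ i ≤ n, w i = (fun j => if hj : j < n + 1 then t ⟨j, hj⟩ else t 0) i} := by
      ext w
      simp only [mem_preimage, mem_singleton_iff, mem_ofPred_eq, funext_iff]
      constructor
      · intro H i hi
        rw [dif_pos (by omega)]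
        exact H ⟨i, by omega⟩
      · intro H i
        have := H i (by omega)
        rw [dif_pos i.2] at this
        exact this
    rw [this]
    exact h _ _
  have aux : ∀ s ∈ measurableCylinders (fun _ : ℕ => X), ν₁ s = ν₂ s := by
    intro s hs
    obtain ⟨I, S, hS, rfl⟩ := (mem_measurableCylinders _).1 hs
    obtain ⟨n, hn⟩ : ∃ n : ℕ, ∀ i ∈ I, i < n + 1 := by
      refine ⟨I.sup id, fun i hi => ?_⟩
      have : id i ≤ I.sup id := Finset.le_sup hi
      simp at this
      omega
    have hm : Measurable (fun (w : ℕ → X) (i : Fin (n+1)) => w i) := by fun_prop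
    have hg : Measurable (fun (t : Fin (n+1) → X) (i : I) => t ⟨i, hn i i.2⟩) := by fun_prop
    have e : cylinder I S = (fun (w : ℕ → X) (i : Fin (n+1)) => w i) ⁻¹'
        ((fun (t : Fin (n+1) → X) (i : I) => t ⟨i, hn i i.2⟩) ⁻¹' S) := by
      ext w; simp [cylinder]; rfl
    rw [e, ← Measure.map_apply hm (hg hS), ← Measure.map_apply hm (hg hS), key]
  refine MeasureTheory.ext_of_generate_finite _ generateFrom_measurableCylinders.symm
    isPiSystem_measurableCylinders aux ?_
  exact aux _ (univ_mem_measurableCylinders _)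

variable {d : ℕ} {Ω : Type*} [MeasurableSpace Ω] (W : SRW d Ω)

/-- trajectory of the jump chain. -/
def traj (ω : Ω) : ℕ → Zd d := fun n => W.Y n ω

lemma measurable_traj : Measurable (traj W) := measurable_pi_lambda _ W.measurable_Y

/-- law of the jump chain. -/
noncomputable def lw (x : Zd d) : Measure (ℕ → Zd d) := (W.P x).map (traj W)

instance (x : Zd d) : IsProbabilityMeasure (W.P x) := W.isProb x

instance (x : Zd d) : IsProbabilityMeasure (lw W x) :=
  Measure.isProbabilityMeasure_map (measurable_traj W).aemeasurable

lemma lw_apply (x : Zd d) {B : Set (ℕ → Zd d)} (hB : MeasurableSet B) :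
    lw W x B = W.P x (traj W ⁻¹' B) := Measure.map_apply (measurable_traj W) hB

lemma expMeasure_univ : expMeasure univ = 1 := by
  unfold expMeasure
  rw [withDensity_apply _ MeasurableSet.univ, Measure.restrict_univ]
  have : (fun t : ℝ => ENNReal.ofReal (if 0 < t then Real.exp (-t) else 0))
     = (Ioi (0:ℝ)).indicator (fun t => ENNReal.ofReal (Real.exp (-t))) := by
    ext t; by_cases h : 0 < t <;> simp [h]
  rw [this, lintegral_indicator measurableSet_Ioi,
    ← ofReal_integral_eq_lintegral_ofReal (integrableOn_exp_neg_Ioi 0)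
     (ae_of_all _ fun t => (Real.exp_pos _).le), integral_exp_neg_Ioi_zero]
  simp

lemma expMeasure_Iic : expMeasure (Iic 0) = 0 := by
  unfold expMeasure
  rw [withDensity_apply _ measurableSet_Iic]
  rw [setLIntegral_congr_fun measurableSet_Iic (g := fun _ => 0)]
  · simp
  · intro t ht
    simp [not_lt.2 (mem_Iic.1 ht)]

lemma expMeasure_Iio : expMeasure (Iio 1) < 1 := by
  have hu := expMeasure_univ
  have h1 : expMeasure (Ici 1) ≠ 0 := by
    unfold expMeasure
    rw [withDensity_apply _ measurableSet_Ici]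
    intro h
    rw [setLIntegral_eq_zero_iff measurableSet_Ici (by
      refine ENNReal.measurable_ofReal.comp ?_
      exact Measurable.ite measurableSet_Ioi (by fun_prop) measurable_const)] at h
    have h2 : (volume : Measure ℝ) (Ici 1) = 0 := by
      refine measure_mono_null ?_ h
      intro t ht
      have : (0:ℝ) < t := lt_of_lt_of_le one_pos ht
      simp [this, Real.exp_pos]
      simpa using ht
    simp at h2
  have h3 : expMeasure (Iio 1) + expMeasure (Ici 1) = 1 := by
    rw [← hu, ← measure_union (by
      rw [Set.disjoint_left]; intro a h1 h2; simp at h1 h2; linarith) measurableSet_Ici]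
    simp
  refine lt_of_le_of_ne (by rw [← h3]; exact le_self_add) fun h => ?_
  rw [h] at h3
  apply h1
  exact (ENNReal.add_right_inj ENNReal.one_ne_top).1 (h3.trans (add_zero 1).symm)

lemma incr_law (x : Zd d) (n : ℕ) (s : Fin n → Zd d) :
    W.P x {ω | ∀ i : Fin n, W.Y ((i : ℕ) + 1) ω - W.Y (i : ℕ) ω = s i} = ∏ i, stepP d (s i) := by
  have := W.law x n s (fun _ => univ) (fun _ => MeasurableSet.univ)
  simpa [expMeasure_univ] using this

lemma zeta_law (x : Zd d) (n : ℕ) (I : Fin n → Set ℝ) (hI : ∀ i, MeasurableSet (I i)) :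
    W.P x {ω | ∀ i : Fin n, W.ζ (i : ℕ) ω ∈ I i} = ∏ i, expMeasure (I i) := by
  let f : Ω → (Fin n → Zd d) := fun ω i => W.Y ((i : ℕ) + 1) ω - W.Y (i : ℕ) ω
  have hf : Measurable f := by
    refine measurable_pi_lambda _ fun i => ?_
    exact (W.measurable_Y _).sub (W.measurable_Y _)
  set E := {ω | ∀ i : Fin n, W.ζ (i : ℕ) ω ∈ I i} with hE
  have hEm : MeasurableSet E := by
    rw [hE, ofPred_forall]
    exact MeasurableSet.iInter fun i => W.measurable_ζ i (hI i)
  have h1 : ∑' s, (W.P x).map f {s} = 1 := by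
    have := Measure.tsum_indicator_apply_singleton ((W.P x).map f) univ MeasurableSet.univ
    simp only [indicator_univ] at this
    rw [this, Measure.map_apply hf MeasurableSet.univ]
    simp
  have h2 : ∑' s, ((W.P x).restrict E).map f {s} = W.P x E := by
    have := Measure.tsum_indicator_apply_singleton (((W.P x).restrict E).map f) univ
      MeasurableSet.univ
    simp only [indicator_univ] at this
    rw [this, Measure.map_apply hf MeasurableSet.univ]
    simp
  have h3 : ∀ s, ((W.P x).restrict E).map f {s}
      = (W.P x).map f {s} * ∏ i, expMeasure (I i) := by
    intro s
    rw [Measure.map_apply hf (measurableSet_singleton _),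
      Measure.map_apply hf (measurableSet_singleton _),
      Measure.restrict_apply (hf (measurableSet_singleton _))]
    have e : f ⁻¹' {s} = {ω | ∀ i : Fin n, W.Y ((i : ℕ) + 1) ω - W.Y (i : ℕ) ω = s i} := by
      ext ω; simp [f, funext_iff]
    rw [e, incr_law, ← W.law x n s I hI]
    rfl
  rw [← h2]
  simp_rw [h3]
  rw [ENNReal.tsum_mul_right, h1, one_mul]

lemma Y_zero_ae (x : Zd d) : ∀ᵐ ω ∂(W.P x), W.Y 0 ω = x := by
  have := W.Y_zero x
  exact (prob_compl_eq_zero_iff (W.measurable_Y 0 (measurableSet_singleton x))).2 this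

/-- weight of a finite path. -/
noncomputable def wt {n : ℕ} (x : Zd d) (t : Fin (n+1) → Zd d) : ℝ≥0∞ :=
  (if t 0 = x then 1 else 0) * ∏ i : Fin n, stepP d (t i.succ - t i.castSucc)

lemma lw_cyl (x : Zd d) (n : ℕ) (t : Fin (n+1) → Zd d) :
    lw W x {w | ∀ i : Fin (n+1), w i = t i} = wt x t := by
  have hm : MeasurableSet {w : ℕ → Zd d | ∀ i : Fin (n+1), w i = t i} := by
    rw [ofPred_forall]
    exact MeasurableSet.iInter fun i => measurable_pi_apply _ (measurableSet_singleton _)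
  rw [lw_apply W x hm]
  unfold wt
  by_cases h : t 0 = x
  · rw [if_pos h, one_mul, ← incr_law W x]
    apply measure_congr
    filter_upwards [Y_zero_ae W x] with ω hω
    apply propext
    change (∀ i : Fin (n+1), W.Y i ω = t i) ↔ (∀ i : Fin n, _)
    constructor
    · intro H i
      have h1 := H i.succ
      have h2 := H i.castSucc
      simp at h1 h2
      rw [h1, h2]
    · intro H i
      induction i using Fin.induction with
      | zero => simp [hω, h]
      | succ i ih =>
        have := H i
        simp at ih
        rw [ih] at this
        simpa using this
  · rw [if_neg h, zero_mul]
    refine measure_mono_null ?_ (Y_zero_ae W x)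
    intro ω hω h2
    apply h
    have := hω 0
    rw [← this]
    exact h2

lemma wt_nat (x : Zd d) (n : ℕ) (a : ℕ → Zd d) :
    lw W x {w | ∀ i ≤ n, w i = a i}
      = (if a 0 = x then 1 else 0) * ∏ i ∈ Finset.range n, stepP d (a (i+1) - a i) := by
  have := lw_cyl W x n (fun i => a i)
  unfold wt at this
  rw [Finset.prod_range]
  simp only [Fin.val_zero, Fin.val_succ, Fin.val_castSucc] at this
  have e : {w : ℕ → Zd d | ∀ i ≤ n, w i = a i} = {w | ∀ i : Fin (n+1), w i = a i} := by
    ext w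
    exact ⟨fun h i => h i (by omega), fun h i hi => h ⟨i, by omega⟩⟩
  rw [e, this]
  congr 1

/-- shift of paths. -/
def shift {X : Type*} (n : ℕ) (w : ℕ → X) : ℕ → X := fun j => w (n + j)

lemma measurable_shift {X : Type*} [MeasurableSpace X] (n : ℕ) :
    Measurable (shift n : (ℕ → X) → ℕ → X) := by
  unfold shift; fun_prop

lemma measurableSet_cyl {X : Type*} [MeasurableSpace X] [MeasurableSingletonClass X]
    (n : ℕ) (a : ℕ → X) : MeasurableSet {w : ℕ → X | ∀ i ≤ n, w i = a i} := by
  simp only [ofPred_forall]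
  exact MeasurableSet.iInter fun i => MeasurableSet.iInter fun _ =>
    measurable_pi_apply _ (measurableSet_singleton _)

lemma markov_cyl (x : Zd d) (n : ℕ) (a : ℕ → Zd d) {B : Set (ℕ → Zd d)} (hB : MeasurableSet B) :
    lw W x ({w | ∀ i ≤ n, w i = a i} ∩ shift n ⁻¹' B)
      = lw W x {w | ∀ i ≤ n, w i = a i} * lw W (a n) B := by
  have hC := measurableSet_cyl n a
  set C := {w : ℕ → Zd d | ∀ i ≤ n, w i = a i} with hCdef
  have hfin : IsFiniteMeasure (lw W x C • lw W (a n)) := by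
    refine ⟨?_⟩
    simp
  have key : ((lw W x).restrict C).map (shift n) = lw W x C • lw W (a n) := by
    refine unique_law _ _ fun m b => ?_
    have hb := measurableSet_cyl m b
    rw [Measure.map_apply (measurable_shift n) hb,
      Measure.restrict_apply (measurable_shift n hb), Measure.smul_apply, smul_eq_mul]
    by_cases h0 : b 0 = a n
    · let c : ℕ → Zd d := fun j => if j ≤ n then a j else b (j - n)
      have hc : ∀ j, c (n + j) = b j := by
        intro j
        by_cases hj : j = 0
        · subst hj; simp [c, h0]
        · simp [c, hj]
      have hc' : ∀ j ≤ n, c j = a j := by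
        intro j hj; simp [c, hj]
      have e : shift n ⁻¹' {w | ∀ i ≤ m, w i = b i} ∩ C = {w | ∀ i ≤ n + m, w i = c i} := by
        ext w
        simp only [mem_inter_iff, mem_preimage, mem_ofPred_eq, hCdef, shift]
        constructor
        · rintro ⟨H1, H2⟩ i hi
          by_cases hin : i ≤ n
          · rw [hc' i hin, H2 i hin]
          · obtain ⟨j, rfl⟩ := Nat.exists_eq_add_of_le (not_le.1 hin).le
            rw [hc, H1 j (by omega)]
        · intro H
          exact ⟨fun i hi => by rw [H _ (by omega), hc], fun i hi => by
            rw [H _ (by omega), hc' _ hi]⟩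
      rw [e, wt_nat, hCdef, wt_nat, wt_nat, Finset.prod_range_add, if_pos h0, hc' 0 (by omega)]
      rw [one_mul, ← mul_assoc]
      congr 1
      · congr 1
        refine Finset.prod_congr rfl fun i hi => ?_
        rw [Finset.mem_range] at hi
        rw [hc' _ (by omega), hc' _ (by omega)]
      · refine Finset.prod_congr rfl fun i hi => ?_
        rw [add_assoc, hc, hc]
    · rw [wt_nat W (a n), if_neg h0]
      simp only [zero_mul, mul_zero]
      convert measure_empty (μ := lw W x)
      ext w
      simp only [mem_inter_iff, mem_preimage, mem_ofPred_eq, hCdef, shift, mem_empty_iff_false,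
        iff_false, not_and]
      intro H1 H2
      apply h0
      rw [← H1 0 (by omega), ← H2 n le_rfl]
      rfl
  have := congrArg (fun ν => ν B) key
  rw [Measure.map_apply (measurable_shift n) hB, Measure.restrict_apply (measurable_shift n hB),
    Measure.smul_apply, smul_eq_mul, inter_comm] at this
  exact this

/-- restriction to the first coordinates. -/
def res {X : Type*} (n : ℕ) (w : ℕ → X) : Fin (n+1) → X := fun i => w i

lemma measurable_res {X : Type*} [MeasurableSpace X] (n : ℕ) :
    Measurable (res n : (ℕ → X) → _) := by
  unfold res; fun_prop

lemma res_preimage {X : Type*} (n : ℕ) (t : Fin (n+1) → X) :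
   res n ⁻¹' {t} = {w | ∀ i ≤ n, w i = (fun j => if hj : j < n + 1 then t ⟨j, hj⟩ else t 0) i} := by
  ext w
  simp only [mem_preimage, mem_singleton_iff, mem_ofPred_eq, funext_iff, res]
  constructor
  · intro H i hi
    rw [dif_pos (by omega)]
    exact H ⟨i, by omega⟩
  · intro H i
    have := H i (by omega)
    rw [dif_pos i.2] at this
    exact this

lemma markov (x y : Zd d) (n : ℕ) (T : Set (Fin (n+1) → Zd d)) {B : Set (ℕ → Zd d)}
    (hB : MeasurableSet B) :
    lw W x (res n ⁻¹' T ∩ {w | w n = y} ∩ shift n ⁻¹' B)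
      = lw W x (res n ⁻¹' T ∩ {w | w n = y}) * lw W y B := by
  have hy : MeasurableSet {w : ℕ → Zd d | w n = y} :=
    measurable_pi_apply _ (measurableSet_singleton _)
  have key : ((lw W x).restrict ({w | w n = y} ∩ shift n ⁻¹' B)).map (res n)
     = lw W y B • ((lw W x).restrict {w | w n = y}).map (res n) := by
    refine Measure.ext_of_singleton fun t => ?_
    have ht := measurable_res n (measurableSet_singleton t)
    rw [Measure.smul_apply, Measure.map_apply (measurable_res n) (measurableSet_singleton _),
      Measure.map_apply (measurable_res n) (measurableSet_singleton _),
      Measure.restrict_apply ht, Measure.restrict_apply ht, ← inter_assoc, smul_eq_mul]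
    by_cases h : t (Fin.last n) = y
    · have e : res n ⁻¹' {t} ∩ {w | w n = y} = res n ⁻¹' {t} := by
        refine inter_eq_left.2 fun w hw => ?_
        rw [← h, ← show res n w = t from hw]
        simp [res]
      rw [e, res_preimage, markov_cyl W x n _ hB, mul_comm]
      rw [dif_pos (by omega)]
      change lw W (t (Fin.last n)) B * _ = _
      rw [h]
    · have e : res n ⁻¹' {t} ∩ {w | w n = y} = ∅ := by
        ext w
        simp only [mem_inter_iff, mem_preimage, mem_singleton_iff, mem_ofPred_eq,
          mem_empty_iff_false, iff_false, not_and]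
        rintro rfl h2
        apply h
        simpa [res] using h2
      rw [e]; simp
  have := congrArg (fun ν => ν T) key
  have hT : MeasurableSet T := MeasurableSet.of_discrete
  have hT' := measurable_res n hT
  simp only [Measure.smul_apply, smul_eq_mul] at this
  rw [Measure.map_apply (measurable_res n) hT, Measure.map_apply (measurable_res n) hT,
    Measure.restrict_apply hT', Measure.restrict_apply hT', ← inter_assoc] at this
  rw [this, mul_comm]

lemma stepP_neg (v : Zd d) : stepP d (-v) = stepP d v := by
  unfold stepP; simp

lemma lw_res (z : Zd d) (n : ℕ) (T : Set (Fin (n+1) → Zd d)) : lw W z (res n ⁻¹' T)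
      = ∑' t, T.indicator (fun t => wt z t) t := by
  have hT : MeasurableSet T := MeasurableSet.of_discrete
  rw [← Measure.map_apply (measurable_res n) hT,
    ← Measure.tsum_indicator_apply_singleton _ _ hT]
  congr 1
  ext t
  congr 1
  ext t
  rw [Measure.map_apply (measurable_res n) (measurableSet_singleton _), ← lw_cyl W]
  congr 1
  ext w; simp [res, funext_iff]

lemma reversal (x y : Zd d) (n : ℕ) (D : Set (Zd d)) :
    lw W x ({w | ∀ i < n, w i ∉ D} ∩ {w | w n = y})
      = lw W y ({w | ∀ i, 1 ≤ i → i ≤ n → w i ∉ D} ∩ {w | w n = x}) := by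
  have e1 : ({w | ∀ i < n, w i ∉ D} ∩ {w | w n = y} : Set (ℕ → Zd d))
     = res n ⁻¹' {t | (∀ i : Fin (n+1), i ≠ Fin.last n → t i ∉ D) ∧ t (Fin.last n) = y} := by
    ext w
    simp only [mem_inter_iff, mem_ofPred_eq, mem_preimage, res, Fin.val_last]
    refine and_congr_left fun _ => ⟨fun H i hi => H i ?_, fun H i hi => H ⟨i, by omega⟩ ?_⟩
    · have := i.2
      have : (i:ℕ) ≠ n := fun h => hi (Fin.ext h)
      omega
    · intro h; have := congrArg Fin.val h; simp at this; omega
  have e2 : ({w | ∀ i, 1 ≤ i → i ≤ n → w i ∉ D} ∩ {w | w n = x} : Set (ℕ → Zd d))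
     = res n ⁻¹' {t | (∀ i : Fin (n+1), i ≠ 0 → t i ∉ D) ∧ t (Fin.last n) = x} := by
    ext w
    simp only [mem_inter_iff, mem_ofPred_eq, mem_preimage, res, Fin.val_last]
    refine and_congr_left fun _ => ⟨fun H i hi => H i ?_ (by omega), fun H i hi hi' => 
      H ⟨i, by omega⟩ ?_⟩
    · have : (i:ℕ) ≠ 0 := fun h => hi (Fin.ext h)
      omega
    · intro h; have := congrArg Fin.val h; simp at this; omega
  rw [e1, e2, lw_res, lw_res, ← (Equiv.arrowCongr (Fin.revPerm (n := n+1)) (Equiv.refl (Zd d))).tsum_eq]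
  congr 1
  ext t
  simp only [indicator, mem_ofPred_eq, wt, Equiv.arrowCongr_apply, Equiv.coe_refl, Function.comp,
    id, Fin.revPerm_symm, Fin.revPerm_apply, Fin.rev_last, Fin.rev_zero, Fin.rev_succ,
    Fin.rev_castSucc]
  have hp : ∏ i : Fin n, stepP d (t i.rev.castSucc - t i.rev.succ)
     = ∏ i : Fin n, stepP d (t i.succ - t i.castSucc) := by
    rw [← Equiv.prod_comp (Fin.revPerm (n := n)) (fun i => stepP d (t i.succ - t i.castSucc))]
    refine Finset.prod_congr rfl fun i _ => ?_
    rw [← stepP_neg]; simp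
  rw [hp]
  have hq : (∀ i : Fin (n+1), i ≠ Fin.last n → t i.rev ∉ D) ↔ (∀ i : Fin (n+1), i ≠ 0 → t i ∉ D) := by
    constructor
    · intro H i hi
      have := H i.rev (by intro h; apply hi; rw [← Fin.rev_rev i, h]; simp)
      simpa using this
    · intro H i hi
      exact H _ (by intro h; apply hi; rw [← Fin.rev_rev i, h]; simp)
  simp only [hq]
  by_cases a : (∀ i : Fin (n+1), i ≠ 0 → t i ∉ D) <;> by_cases b : t 0 = y <;>
    by_cases c : t (Fin.last n) = x <;> simp [a, b, c]


/-- first visit to `S` occurs, and the path after it lies in `B`. -/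
def FH (S : Set (Zd d)) (B : Set (ℕ → Zd d)) : Set (ℕ → Zd d) :=
  {w | ∃ n, (∀ i < n, w i ∉ S) ∧ w n ∈ S ∧ shift n w ∈ B}

/-- some visit to `S` occurs, with the path after it in `B`. -/
def ev (S : Set (Zd d)) (B : Set (ℕ → Zd d)) : Set (ℕ → Zd d) :=
  {w | ∃ n, w n ∈ S ∧ shift n w ∈ B}

lemma measurableSet_coord (n : ℕ) (S : Set (Zd d)) : MeasurableSet {w : ℕ → Zd d | w n ∈ S} :=
  measurable_pi_apply n (MeasurableSet.of_discrete (s := S))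

lemma measurableSet_ev (S : Set (Zd d)) {B : Set (ℕ → Zd d)} (hB : MeasurableSet B) :
    MeasurableSet (ev S B) := by
  have : ev S B = ⋃ n, {w : ℕ → Zd d | w n ∈ S} ∩ shift n ⁻¹' B := by
    ext w; simp [ev]
  rw [this]
  exact MeasurableSet.iUnion fun n => (measurableSet_coord n S).inter (measurable_shift n hB)

lemma measurableSet_avoid (p : ℕ → Prop) (S : Set (Zd d)) :
    MeasurableSet {w : ℕ → Zd d | ∀ i, p i → w i ∉ S} := by
  simp only [ofPred_forall]
  exact MeasurableSet.iInter fun i => MeasurableSet.iInter fun _ => measurableSet_coord i Sᶜ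

lemma shift_shift {X : Type*} (n m : ℕ) (w : ℕ → X) : shift m (shift n w) = shift (n + m) w := by
  ext j; simp [shift, add_assoc]

lemma ev_back (S : Set (Zd d)) (B : Set (ℕ → Zd d)) (n : ℕ) (w : ℕ → Zd d)
    (h : shift n w ∈ ev S B) : w ∈ ev S B := by
  obtain ⟨m, h1, h2⟩ := h
  exact ⟨n + m, h1, by rwa [shift_shift] at h2⟩

lemma ev_eq_FH (S : Set (Zd d)) (B : Set (ℕ → Zd d))
    (hB : ∀ n w, shift n w ∈ B → w ∈ B) : ev S B = FH S B := by
  ext w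
  constructor
  · rintro ⟨n, h1, h2⟩
    have hex : ∃ n, w n ∈ S := ⟨n, h1⟩
    refine ⟨Nat.find hex, fun i hi => Nat.find_min hex hi, Nat.find_spec hex, ?_⟩
    have hle : Nat.find hex ≤ n := Nat.find_min' hex h1
    apply hB (n - Nat.find hex)
    rw [shift_shift, Nat.add_sub_cancel' hle]
    exact h2
  · rintro ⟨n, _, h1, h2⟩
    exact ⟨n, h1, h2⟩

lemma avoid_res (n : ℕ) (S : Set (Zd d)) : ({w | ∀ i < n, w i ∉ S} : Set (ℕ → Zd d))
     = res n ⁻¹' {t | ∀ i : Fin (n+1), (i : ℕ) < n → t i ∉ S} := by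
  ext w
  exact ⟨fun H i hi => H i hi, fun H i hi => H ⟨i, by omega⟩ hi⟩

lemma avoid_res' (n : ℕ) (S : Set (Zd d)) :
    ({w | ∀ i, 1 ≤ i → i ≤ n → w i ∉ S} : Set (ℕ → Zd d))
     = res n ⁻¹' {t | ∀ i : Fin (n+1), 1 ≤ (i : ℕ) → t i ∉ S} := by
  ext w
  exact ⟨fun H i hi => H i hi (by omega), fun H i hi hi' => H ⟨i, by omega⟩ hi⟩

lemma firstHit (x : Zd d) (S : Set (Zd d)) {B : Set (ℕ → Zd d)} (hB : MeasurableSet B) :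
    lw W x (FH S B) = ∑' p : ℕ × S,
      lw W x ({w | ∀ i < p.1, w i ∉ S} ∩ {w | w p.1 = (p.2 : Zd d)}) * lw W p.2 B := by
  have e : FH S B = ⋃ p : ℕ × S,
      {w | ∀ i < p.1, w i ∉ S} ∩ {w | w p.1 = (p.2 : Zd d)} ∩ shift p.1 ⁻¹' B := by
    ext w
    simp only [FH, mem_ofPred_eq, mem_iUnion, mem_inter_iff, mem_preimage, Prod.exists]
    constructor
    · rintro ⟨n, h1, h2, h3⟩
      exact ⟨n, ⟨w n, h2⟩, ⟨h1, rfl⟩, h3⟩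
    · rintro ⟨n, y, ⟨h1, h2⟩, h3⟩
      exact ⟨n, h1, h2 ▸ y.2, h3⟩
  rw [e, measure_iUnion]
  · congr 1
    ext p
    rw [avoid_res, markov W x _ _ _ hB]
  · rintro ⟨n, y⟩ ⟨m, z⟩ hne
    rw [Function.onFun, Set.disjoint_left]
    rintro w ⟨⟨h1, h2⟩, -⟩ ⟨⟨h3, h4⟩, -⟩
    simp only [mem_ofPred_eq] at h1 h2 h3 h4
    have hnm : n = m := by
      rcases lt_trichotomy n m with h | h | h
      · exact absurd (h2 ▸ y.2) (h3 n h)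
      · exact h
      · exact absurd (h4 ▸ z.2) (h1 m h)
    subst hnm
    exact hne (Prod.ext rfl (Subtype.ext (h2.symm.trans h4)))
  · intro p
    exact ((measurableSet_avoid (fun i => i < p.1) S).inter
      (measurable_pi_apply _ (measurableSet_singleton _))).inter (measurable_shift _ hB)

lemma strong (x : Zd d) (S : Set (Zd d)) {B : Set (ℕ → Zd d)} (hB : MeasurableSet B) (c : ℝ≥0∞)
    (h : ∀ n, ∀ y ∈ S, lw W x ({w | ∀ i < n, w i ∉ S} ∩ {w | w n = y}) ≠ 0 → lw W y B ≤ c) :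
    lw W x (FH S B) ≤ c * lw W x (FH S univ) := by
  rw [firstHit W x S hB, firstHit W x S MeasurableSet.univ, ← ENNReal.tsum_mul_left]
  refine ENNReal.tsum_le_tsum fun p => ?_
  by_cases h0 : lw W x ({w | ∀ i < p.1, w i ∉ S} ∩ {w | w p.1 = (p.2 : Zd d)}) = 0
  · rw [h0]; simp
  · rw [measure_univ, mul_one, mul_comm]
    gcongr
    exact h _ _ p.2.2 h0

lemma exit_bdry (x : Zd d) (U : Set (Zd d)) (hx : x ∈ U) (n : ℕ) (z : Zd d) (hz : z ∉ U)
    (h : lw W x ({w | ∀ i < n, w i ∉ Uᶜ} ∩ {w | w n = z}) ≠ 0) : z ∈ bdry U := by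
  have e : ({w | ∀ i < n, w i ∉ Uᶜ} ∩ {w | w n = z} : Set (ℕ → Zd d))
     = res n ⁻¹' {t | (∀ i : Fin (n+1), (i : ℕ) < n → t i ∉ Uᶜ) ∧ t (Fin.last n) = z} := by
    rw [avoid_res]
    ext w
    simp [res]
  rw [e, lw_res] at h
  obtain ⟨t, ht⟩ : ∃ t, ({t | (∀ i : Fin (n+1), (i : ℕ) < n → t i ∉ Uᶜ) ∧
      t (Fin.last n) = z}).indicator (fun t => wt x t) t ≠ 0 := by
    by_contra hcon
    push Not at hcon
    exact h (by simp only [hcon, tsum_zero])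
  have hmem := mem_of_indicator_ne_zero ht
  rw [indicator_of_mem hmem] at ht
  obtain ⟨hm1, hm2⟩ := hmem
  unfold wt at ht
  have h0 : t 0 = x := by
    by_contra h0
    exact ht (by rw [if_neg h0, zero_mul])
  refine ⟨hz, ?_⟩
  rcases n with _ | n
  · exfalso
    apply hz
    rw [← hm2]
    have : Fin.last 0 = (0 : Fin 1) := rfl
    rw [this, h0]; exact hx
  · have hp := right_ne_zero_of_mul ht
    have hs := (Finset.prod_ne_zero_iff.1 hp) (Fin.last n) (Finset.mem_univ _)
    refine ⟨t (Fin.last n).castSucc, ?_, ?_⟩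
    · have := hm1 (Fin.last n).castSucc (by simp)
      simpa using this
    · unfold stepP at hs
      rw [Fin.succ_last, hm2] at hs
      have : (∑ i, ((z - t (Fin.last n).castSucc) i).natAbs) = 1 := by
        by_contra hne
        rw [if_neg hne] at hs
        exact hs rfl
      unfold adjacent
      refine Eq.trans ?_ this
      refine Finset.sum_congr rfl fun i _ => ?_
      rw [Pi.sub_apply, ← Int.natAbs_neg, neg_sub]

/-- at least `k` excursions. -/
def AD (D U : Set (Zd d)) : ℕ → Set (ℕ → Zd d)
  | 0 => univ
  | k + 1 => ev D (ev Uᶜ (AD D U k))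

lemma measurableSet_AD (D U : Set (Zd d)) (k : ℕ) : MeasurableSet (AD D U k) := by
  induction k with
  | zero => exact MeasurableSet.univ
  | succ k ih => exact measurableSet_ev _ (measurableSet_ev _ ih)

lemma AD_back (D U : Set (Zd d)) (k n : ℕ) (w : ℕ → Zd d) (h : shift n w ∈ AD D U k) :
    w ∈ AD D U k := by
  cases k with
  | zero => exact mem_univ _
  | succ k => exact ev_back _ _ _ _ h

lemma AD_anti_succ (D U : Set (Zd d)) (k : ℕ) : AD D U (k+1) ⊆ AD D U k := by
  rintro w ⟨n, _, m, _, h⟩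
  exact AD_back _ _ _ _ _ (AD_back _ _ _ _ _ h)

lemma AD_bound (D U : Set (Zd d)) (hDU : D ⊆ U) (q : ℝ≥0∞)
    (hq : ∀ z ∈ bdry U, lw W z (ev D univ) ≤ q) (k : ℕ) (x : Zd d) :
    lw W x (AD D U (k+1)) ≤ q ^ k * lw W x (ev D univ) := by
  have hE : ev D univ = FH D univ := ev_eq_FH D univ fun _ _ _ => mem_univ _
  have step : ∀ k x, (∀ y ∈ U, lw W y (ev Uᶜ (AD D U k)) ≤ q ^ k) →
      lw W x (AD D U (k+1)) ≤ q ^ k * lw W x (ev D univ) := by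
    intro k x H
    rw [hE]
    change lw W x (ev D (ev Uᶜ (AD D U k))) ≤ _
    rw [ev_eq_FH _ _ (ev_back _ _)]
    exact strong W x D (measurableSet_ev _ (measurableSet_AD D U k)) _
      fun n y hy _ => H y (hDU hy)
  apply step
  induction k with
  | zero => intro y _; simpa using prob_le_one
  | succ k ih =>
    intro y hy
    rw [ev_eq_FH _ _ (AD_back D U (k+1))]
    refine (strong W y Uᶜ (measurableSet_AD D U (k+1)) (q ^ (k+1)) ?_).trans ?_
    · intro n z hz hne
      have hb := exit_bdry W y U hy n z hz hne
      refine (step k z ih).trans ?_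
      rw [pow_succ]
      gcongr
      exact hq z hb
    · exact mul_le_of_le_one_right' prob_le_one

lemma sweep (D E : Set (Zd d)) (hDE : D ⊆ E) :
    ∑' x : E, lw W x {w | ∀ j, 1 ≤ j → w j ∉ E} * lw W x (ev D univ)
      ≤ ∑' y : D, lw W y {w | ∀ j, 1 ≤ j → w j ∉ D} := by
  have hE : ev D univ = FH D univ := ev_eq_FH D univ fun _ _ _ => mem_univ _
  have hav : MeasurableSet {w : ℕ → Zd d | ∀ j, 1 ≤ j → w j ∉ E} := measurableSet_avoid _ _
  let G : D → ℕ → E → Set (ℕ → Zd d) := fun y n x =>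
    {w | ∀ i, 1 ≤ i → i ≤ n → w i ∉ D} ∩ {w | w n = (x : Zd d)} ∩
      shift n ⁻¹' {w | ∀ j, 1 ≤ j → w j ∉ E}
  have h1 : ∀ x : E, lw W x {w | ∀ j, 1 ≤ j → w j ∉ E} * lw W x (ev D univ)
      = ∑' n : ℕ, ∑' y : D, lw W y (G y n x) := by
    intro x
    rw [hE, firstHit W x D MeasurableSet.univ, ← ENNReal.tsum_mul_left, ENNReal.tsum_prod']
    congr 1; ext n; congr 1; ext y
    simp only [G]
    rw [avoid_res', markov W _ _ _ _ hav, ← avoid_res', ← reversal, measure_univ, mul_one, mul_comm]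
  simp_rw [h1]
  have h2 : ∑' x : E, ∑' n : ℕ, ∑' y : D, lw W y (G y n x)
     = ∑' y : D, ∑' p : ℕ × E, lw W y (G y p.1 p.2) := by
    rw [ENNReal.tsum_comm]
    have : ∀ n : ℕ, ∑' x : E, ∑' y : D, lw W y (G y n x) = ∑' y : D, ∑' x : E, lw W y (G y n x) :=
      fun n => ENNReal.tsum_comm
    simp_rw [this]
    rw [ENNReal.tsum_comm]
    congr 1; ext y
    rw [ENNReal.tsum_prod']
  rw [h2]
  refine ENNReal.tsum_le_tsum fun y => ?_
  rw [← measure_iUnion]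
  · refine measure_mono ?_
    intro w hw
    simp only [mem_iUnion, G] at hw
    obtain ⟨⟨n, x⟩, ⟨ha, hb⟩, hc⟩ := hw
    intro j hj hjD
    by_cases hjn : j ≤ n
    · exact ha j hj hjn hjD
    · have := hc (j - n) (by omega)
      simp only [shift] at this
      rw [Nat.add_sub_cancel' (by omega)] at this
      exact this (hDE hjD)
  · rintro ⟨n, x⟩ ⟨m, z⟩ hne
    rw [Function.onFun, Set.disjoint_left]
    rintro w ⟨⟨-, h2⟩, h3⟩ ⟨⟨-, h5⟩, h6⟩
    simp only [mem_ofPred_eq, mem_preimage, shift] at h2 h3 h5 h6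
    have hnm : n = m := by
      rcases lt_trichotomy n m with h | h | h
      · have := h3 (m - n) (by omega)
        rw [Nat.add_sub_cancel' (by omega), h5] at this
        exact absurd z.2 this
      · exact h
      · have := h6 (n - m) (by omega)
        rw [Nat.add_sub_cancel' (by omega), h2] at this
        exact absurd x.2 this
    subst hnm
    exact hne (Prod.ext rfl (Subtype.ext (h2.symm.trans h5)))
  · rintro ⟨n, x⟩
    simp only [G]
    rw [avoid_res']
    exact (((measurable_res n) MeasurableSet.of_discrete).inter
      (measurable_pi_apply _ (measurableSet_singleton _))).inter (measurable_shift _ hav)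


/-- the good event: positive holding times and no explosion. -/
def good (ω : Ω) : Prop := (∀ i, 0 < W.ζ i ω) ∧ ∀ n, ∃ i ≥ n, 1 ≤ W.ζ i ω

lemma good_ae (x : Zd d) : ∀ᵐ ω ∂(W.P x), good W ω := by
  refine Filter.Eventually.and ?_ ?_
  · rw [ae_all_iff]
    intro i
    have := zeta_law W x (i+1) (fun j => if (j : ℕ) = i then Iic 0 else univ)
      (fun j => by split_ifs <;> measurability)
    rw [Finset.prod_eq_zero (Finset.mem_univ (Fin.last i)) (by simp [expMeasure_Iic])] at this
    refine measure_mono_null ?_ this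
    intro ω hω j
    have h : W.ζ i ω ≤ 0 := not_lt.1 hω
    by_cases hj : (j : ℕ) = i
    · simp [hj, h]
    · simp [hj]
  · rw [ae_all_iff]
    intro n
    have hb : ∀ m : ℕ, W.P x {ω | ¬ ∃ i ≥ n, 1 ≤ W.ζ i ω} ≤ expMeasure (Iio 1) ^ m := by
      intro m
      have := zeta_law W x (n+m) (fun j => if (j : ℕ) < n then univ else Iio 1)
        (fun j => by split_ifs <;> measurability)
      have hpr : ∏ j : Fin (n+m), expMeasure (if (j : ℕ) < n then univ else Iio 1)
          = expMeasure (Iio 1) ^ m := by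
        rw [Fin.prod_univ_add]
        simp [expMeasure_univ]
      rw [← hpr, ← this]
      refine measure_mono ?_
      intro ω hω j
      by_cases hj : (j : ℕ) < n
      · simp [hj]
      · simp only [hj, if_false, mem_Iio]
        by_contra hc
        exact hω ⟨j, not_lt.1 hj, not_lt.1 hc⟩
    have ht := ENNReal.tendsto_pow_atTop_nhds_zero_of_lt_one expMeasure_Iio
    exact le_antisymm (ge_of_tendsto' ht hb) zero_le

variable {W}

lemma S_strictMono {ω : Ω} (h : good W ω) : StrictMono (fun n => W.S n ω) := by
  refine strictMono_nat_of_lt_succ fun n => ?_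
  simp only [SRW.S, Finset.sum_range_succ]
  have := h.1 n
  linarith

lemma S_zero (ω : Ω) : W.S 0 ω = 0 := by simp [SRW.S]

lemma S_unbdd {ω : Ω} (h : good W ω) (M : ℕ) : ∃ n, (M : ℝ) ≤ W.S n ω := by
  induction M with
  | zero => exact ⟨0, by simp [S_zero]⟩
  | succ M ih =>
    obtain ⟨n, hn⟩ := ih
    obtain ⟨i, hi, h1⟩ := h.2 n
    refine ⟨i + 1, ?_⟩
    have := (S_strictMono h).monotone hi
    have e : W.S (i+1) ω = W.S i ω + W.ζ i ω := by simp [SRW.S, Finset.sum_range_succ]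
    push_cast
    linarith

lemma jump_bdd {ω : Ω} (h : good W ω) (t : ℝ) : BddAbove {k : ℕ | W.S k ω ≤ t} := by
  obtain ⟨M, hM⟩ := exists_nat_gt t
  obtain ⟨n, hn⟩ := S_unbdd h M
  refine ⟨n, fun k hk => ?_⟩
  by_contra hc
  have := (S_strictMono h).monotone (not_le.1 hc).le
  simp only [mem_ofPred_eq] at this hk
  linarith

lemma jump_le {ω : Ω} (h : good W ω) {t : ℝ} (ht : 0 ≤ t) : W.S (W.jumpIdx t ω) ω ≤ t := by
  have : W.jumpIdx t ω ∈ {k : ℕ | W.S k ω ≤ t} :=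
    Nat.sSup_mem ⟨0, by simpa [S_zero] using ht⟩ (jump_bdd h t)
  exact this

lemma lt_jump {ω : Ω} (h : good W ω) (t : ℝ) : t < W.S (W.jumpIdx t ω + 1) ω := by
  by_contra hc
  have : W.jumpIdx t ω + 1 ≤ W.jumpIdx t ω :=
    le_csSup (jump_bdd h t) (show W.jumpIdx t ω + 1 ∈ {k : ℕ | W.S k ω ≤ t} from not_lt.1 hc)
  omega

lemma le_jump {ω : Ω} (h : good W ω) {t : ℝ} {k : ℕ} (hk : W.S k ω ≤ t) : k ≤ W.jumpIdx t ω :=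
  le_csSup (jump_bdd h t) hk

lemma jump_mono {ω : Ω} (h : good W ω) {s t : ℝ} (hs : 0 ≤ s) (hst : s ≤ t) :
    W.jumpIdx s ω ≤ W.jumpIdx t ω := le_jump h ((jump_le h hs).trans hst)

lemma jump_eq {ω : Ω} (h : good W ω) {t : ℝ} {k : ℕ} (hk : W.S k ω ≤ t)
    (hk' : t < W.S (k+1) ω) : W.jumpIdx t ω = k := by
  refine le_antisymm ?_ (le_jump h hk)
  have h0 : 0 ≤ t := by
    refine le_trans ?_ hk
    rw [← S_zero (W := W) ω]
    exact (S_strictMono h).monotone (Nat.zero_le _)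
  have := (S_strictMono h).lt_iff_lt.1 (lt_of_le_of_lt (jump_le h h0) hk')
  omega

lemma hitFrom_top (A : Set (Zd d)) (t : ℝ≥0∞) (ω : Ω) :
    W.hitFrom A t ω = ⊤ ↔ ∀ s : ℝ≥0, t ≤ s → W.X s ω ∉ A := by
  unfold SRW.hitFrom
  rw [sInf_eq_top]
  constructor
  · intro H s hs hX
    exact ENNReal.coe_ne_top (H s ⟨s, rfl, hs, hX⟩)
  · rintro H u ⟨s, rfl, hs, hX⟩
    exact absurd hX (H s hs)

lemma S_nonneg {ω : Ω} (h : good W ω) (n : ℕ) : 0 ≤ W.S n ω := by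
  rw [← S_zero (W := W) ω]
  exact (S_strictMono h).monotone (Nat.zero_le _)

lemma X_S {ω : Ω} (h : good W ω) (n : ℕ) : W.X (W.S n ω) ω = W.Y n ω := by
  unfold SRW.X
  rw [jump_eq h le_rfl (S_strictMono h (Nat.lt_succ_self n))]

lemma hit_top {ω : Ω} (h : good W ω) (A : Set (Zd d)) :
    W.hit A ω = ⊤ ↔ ∀ n, W.Y n ω ∉ A := by
  unfold SRW.hit
  rw [hitFrom_top]
  constructor
  · intro H n hn
    refine H (W.S n ω).toNNReal zero_le ?_
    rw [Real.coe_toNNReal _ (S_nonneg h n), X_S h]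
    exact hn
  · intro H s _
    exact H _

lemma hitTilde_top {ω : Ω} (h : good W ω) (A : Set (Zd d)) :
    W.hitTilde A ω = ⊤ ↔ ∀ n, 1 ≤ n → W.Y n ω ∉ A := by
  unfold SRW.hitTilde
  rw [hitFrom_top]
  have h1 : W.S 1 ω = W.ζ 0 ω := by simp [SRW.S]
  constructor
  · intro H n hn1 hn
    refine H (W.S n ω).toNNReal ?_ ?_
    · change ENNReal.ofReal _ ≤ ENNReal.ofReal _
      apply ENNReal.ofReal_le_ofReal
      rw [← h1]
      exact (S_strictMono h).monotone hn1
    · rw [Real.coe_toNNReal _ (S_nonneg h n), X_S h]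
      exact hn
  · intro H s hs
    refine H _ (le_jump h ?_)
    rw [ENNReal.ofReal_le_iff_le_toReal ENNReal.coe_ne_top] at hs
    rw [h1]
    exact hs

lemma hitFrom_attain {ω : Ω} (h : good W ω) (A : Set (Zd d)) (t : ℝ≥0∞)
    (ht : W.hitFrom A t ω < ⊤) :
    ∃ u : ℝ≥0, W.hitFrom A t ω = u ∧ t ≤ u ∧ W.Y (W.jumpIdx u ω) ω ∈ A := by
  obtain ⟨u, hu⟩ : ∃ u : ℝ≥0, W.hitFrom A t ω = u :=
    ⟨(W.hitFrom A t ω).toNNReal, (ENNReal.coe_toNNReal ht.ne).symm⟩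
  have htu : t ≤ u := by
    rw [← hu]
    refine le_sInf ?_
    rintro v ⟨s, rfl, hs, _⟩
    exact hs
  refine ⟨u, hu, htu, ?_⟩
  have hlt := lt_jump h (u : ℝ)
  have hlt' : W.hitFrom A t ω < ((W.S (W.jumpIdx u ω + 1) ω).toNNReal : ℝ≥0∞) := by
    rw [hu, ENNReal.coe_lt_coe, Real.lt_toNNReal_iff_coe_lt]
    exact hlt
  obtain ⟨v, ⟨s, rfl, hs, hX⟩, hv⟩ := sInf_lt_iff.1 hlt'
  have hle : W.hitFrom A t ω ≤ s := sInf_le ⟨s, rfl, hs, hX⟩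
  rw [hu, ENNReal.coe_le_coe] at hle
  rw [ENNReal.coe_lt_coe, Real.lt_toNNReal_iff_coe_lt] at hv
  have hus : (u : ℝ) ≤ s := hle
  have : W.jumpIdx s ω = W.jumpIdx u ω :=
    jump_eq h ((jump_le h u.2).trans hus) hv
  unfold SRW.X at hX
  rwa [this] at hX

lemma AD_of_Dt {ω : Ω} (h : good W ω) (D U : Set (Zd d)) (k : ℕ) :
    ∀ l, ∀ u : ℝ≥0, W.Dt D U k ω = u → shift (W.jumpIdx u ω) (traj W ω) ∈ AD D U l →
      traj W ω ∈ AD D U (l + k + 1) := by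
  have one : ∀ (l : ℕ) (r u : ℝ≥0), r ≤ u → W.Y (W.jumpIdx r ω) ω ∈ D →
      W.Y (W.jumpIdx u ω) ω ∈ Uᶜ → shift (W.jumpIdx u ω) (traj W ω) ∈ AD D U l →
      ∀ v ≤ r, shift (W.jumpIdx (v : ℝ≥0) ω) (traj W ω) ∈ AD D U (l + 1) := by
    intro l r u hru hr hu hl v hv
    have h1 : W.jumpIdx v ω ≤ W.jumpIdx r ω := jump_mono h v.2 hv
    have h2 : W.jumpIdx r ω ≤ W.jumpIdx u ω := jump_mono h r.2 hru
    refine ⟨W.jumpIdx r ω - W.jumpIdx v ω, ?_, W.jumpIdx u ω - W.jumpIdx r ω, ?_, ?_⟩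
    · simp only [shift, traj]
      rwa [Nat.add_sub_cancel' h1]
    · rw [shift_shift, Nat.add_sub_cancel' h1]
      simp only [shift, traj]
      rwa [Nat.add_sub_cancel' h2]
    · rw [shift_shift, shift_shift, ← add_assoc, Nat.add_sub_cancel' h1, Nat.add_sub_cancel' h2]
      exact hl
  induction k with
  | zero =>
    intro l u hu hl
    obtain ⟨u', hu', hru, hY⟩ := hitFrom_attain h Uᶜ (W.Rt D U 0 ω)
      (by change W.Dt D U 0 ω < ⊤; rw [hu]; exact ENNReal.coe_lt_top)
    have : u' = u := by
      have e : W.Dt D U 0 ω = u' := hu'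
      rw [hu] at e
      exact_mod_cast e.symm
    subst this
    have hR : W.hitFrom D 0 ω < ⊤ := lt_of_le_of_lt hru ENNReal.coe_lt_top
    obtain ⟨r, hr, _, hYr⟩ := hitFrom_attain h D 0 hR
    have hru' : (r : ℝ≥0∞) ≤ u' := hr ▸ hru
    have := one l r u' (by exact_mod_cast hru') hYr hY hl 0 zero_le
    exact AD_back _ _ _ _ _ this
  | succ k ih =>
    intro l u hu hl
    obtain ⟨u', hu', hru, hY⟩ := hitFrom_attain h Uᶜ (W.Rt D U (k+1) ω)
      (by change W.Dt D U (k+1) ω < ⊤; rw [hu]; exact ENNReal.coe_lt_top)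
    have : u' = u := by
      have e : W.Dt D U (k+1) ω = u' := hu'
      rw [hu] at e
      exact_mod_cast e.symm
    subst this
    have hR : W.hitFrom D (W.Dt D U k ω) ω < ⊤ := lt_of_le_of_lt hru ENNReal.coe_lt_top
    obtain ⟨r, hr, hvr, hYr⟩ := hitFrom_attain h D _ hR
    have hru' : (r : ℝ≥0∞) ≤ u' := hr ▸ hru
    obtain ⟨v, hv⟩ : ∃ v : ℝ≥0, W.Dt D U k ω = v :=
      ⟨_, (ENNReal.coe_toNNReal (lt_of_le_of_lt hvr ENNReal.coe_lt_top).ne).symm⟩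
    rw [hv] at hvr
    have := one l r u' (by exact_mod_cast hru') hYr hY hl v (by exact_mod_cast hvr)
    have := ih (l+1) v hv this
    rwa [show l + 1 + k + 1 = l + (k + 1) + 1 by ring] at this

lemma AD_anti (D U : Set (Zd d)) {k l : ℕ} (h : k ≤ l) : AD D U l ⊆ AD D U k :=
  antitone_nat_of_succ_le (f := AD D U) (AD_anti_succ D U) h

lemma AD_Nexc {ω : Ω} (h : good W ω) (D U : Set (Zd d)) (k : ℕ) (hk : k < W.Nexc D U ω) :
    traj W ω ∈ AD D U (k + 1) := by
  have hN : 0 < sSup {n | 0 < n ∧ W.Dt D U (n - 1) ω < ⊤} := lt_of_le_of_lt (Nat.zero_le _) hk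
  have hne : {n | 0 < n ∧ W.Dt D U (n - 1) ω < ⊤}.Nonempty := by
    by_contra hc
    rw [not_nonempty_iff_eq_empty] at hc
    rw [hc] at hN
    simp at hN
  have hb : BddAbove {n | 0 < n ∧ W.Dt D U (n - 1) ω < ⊤} := by
    by_contra hc
    rw [Nat.sSup_of_not_bddAbove hc] at hN
    exact lt_irrefl _ hN
  have hmem : W.Nexc D U ω ∈ {n | 0 < n ∧ W.Dt D U (n - 1) ω < ⊤} := Nat.sSup_mem hne hb
  obtain ⟨h1, h2⟩ := hmem
  have := AD_of_Dt h D U (W.Nexc D U ω - 1) 0 _ (ENNReal.coe_toNNReal h2.ne).symm (mem_univ _)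
  exact AD_anti D U (by omega) this

lemma exp_le_pointwise {ω : Ω} (h : good W ω) (D U : Set (Zd d)) (lam : ℝ) (hlam : 0 < lam) :
    ENNReal.ofReal (Real.exp (lam * (W.Nexc D U ω : ℝ))) ≤
      1 + ∑' k : ℕ, (AD D U (k+1)).indicator
        (fun _ => ENNReal.ofReal (Real.exp lam ^ k * (Real.exp lam - 1))) (traj W ω) := by
  have hr : 1 < Real.exp lam := Real.one_lt_exp_iff.2 hlam
  have hc : ∀ k : ℕ, 0 ≤ Real.exp lam ^ k * (Real.exp lam - 1) := fun k =>
    mul_nonneg (pow_nonneg (Real.exp_pos _).le _) (by linarith)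
  have e : Real.exp (lam * (W.Nexc D U ω : ℝ))
      = 1 + ∑ k ∈ Finset.range (W.Nexc D U ω), Real.exp lam ^ k * (Real.exp lam - 1) := by
    rw [← Finset.sum_mul, geom_sum_mul, mul_comm, Real.exp_nat_mul]
    ring
  rw [e, ENNReal.ofReal_add zero_le_one (Finset.sum_nonneg fun k _ => hc k), ENNReal.ofReal_one,
    ENNReal.ofReal_sum_of_nonneg fun k _ => hc k]
  gcongr
  refine le_trans ?_ (ENNReal.sum_le_tsum (Finset.range (W.Nexc D U ω)))
  refine Finset.sum_le_sum fun k hk => ?_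
  rw [indicator_of_mem (AD_Nexc h D U k (Finset.mem_range.1 hk))]

lemma exp_bound (x : Zd d) (D U : Set (Zd d)) (hDU : D ⊆ U) (lam : ℝ) (hlam : 0 < lam)
    (q : ℝ) (hq0 : 0 ≤ q) (hcond : Real.exp lam * q < 1)
    (hq : ∀ z ∈ bdry U, lw W z (ev D univ) ≤ ENNReal.ofReal q) :
    ∫⁻ ω, ENNReal.ofReal (Real.exp (lam * (W.Nexc D U ω : ℝ))) ∂(W.P x)
      ≤ 1 + ENNReal.ofReal ((Real.exp lam - 1) / (1 - Real.exp lam * q)) * lw W x (ev D univ) := by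
  have hr : 1 < Real.exp lam := Real.one_lt_exp_iff.2 hlam
  calc _ ≤ ∫⁻ ω, (1 + ∑' k : ℕ, (AD D U (k+1)).indicator
        (fun _ => ENNReal.ofReal (Real.exp lam ^ k * (Real.exp lam - 1))) (traj W ω)) ∂(W.P x) := by
        refine lintegral_mono_ae ?_
        filter_upwards [good_ae W x] with ω hω
        exact exp_le_pointwise hω D U lam hlam
    _ = 1 + ∑' k : ℕ, ENNReal.ofReal (Real.exp lam ^ k * (Real.exp lam - 1)) *
          lw W x (AD D U (k+1)) := by
        rw [lintegral_add_left measurable_const, lintegral_tsum]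
        · congr 1
          · simp
          · congr 1; ext k
            rw [lw_apply W x (measurableSet_AD D U (k+1)),
              ← lintegral_indicator_const (measurable_traj W (measurableSet_AD D U (k+1)))]
            rfl
        · intro k
          exact ((measurable_const.indicator (measurableSet_AD D U (k+1))).comp
            (measurable_traj W)).aemeasurable
    _ ≤ 1 + ∑' k : ℕ, ENNReal.ofReal (Real.exp lam * q) ^ k *
          (ENNReal.ofReal (Real.exp lam - 1) * lw W x (ev D univ)) := by
        refine add_le_add_right (ENNReal.tsum_le_tsum fun k => ?_) _
        refine (mul_le_mul_right (AD_bound W D U hDU _ hq k x) _).trans (le_of_eq ?_)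
        rw [ENNReal.ofReal_mul (pow_nonneg (Real.exp_pos _).le _),
          ENNReal.ofReal_pow (Real.exp_pos _).le, ENNReal.ofReal_mul (Real.exp_pos _).le, mul_pow]
        ring
    _ = _ := by
        rw [ENNReal.tsum_mul_right, ENNReal.tsum_geometric, ← ENNReal.ofReal_one,
          ← ENNReal.ofReal_sub _ (mul_nonneg (Real.exp_pos _).le hq0),
          ← ENNReal.ofReal_inv_of_pos (by linarith), ← mul_assoc,
          ← ENNReal.ofReal_mul (inv_nonneg.2 (by linarith)), div_eq_inv_mul]

lemma lw_hit (x : Zd d) (D : Set (Zd d)) :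
    lw W x (ev D univ) = ENNReal.ofReal (1 - (W.P x {ω | W.hit D ω = ⊤}).toReal) := by
  have hm := measurableSet_ev D (MeasurableSet.univ (α := ℕ → Zd d))
  have e : W.P x {ω | W.hit D ω = ⊤} = lw W x (ev D univ)ᶜ := by
    rw [lw_apply W x hm.compl]
    apply measure_congr
    filter_upwards [good_ae W x] with ω hω
    apply propext
    change W.hit D ω = ⊤ ↔ traj W ω ∉ ev D univ
    rw [hit_top hω]
    simp [ev, traj]
  rw [e, prob_compl_eq_one_sub hm, ENNReal.toReal_sub_of_le prob_le_one ENNReal.one_ne_top]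
  simp

lemma eqm_eq (A : Set (Zd d)) (x : Zd d) :
    ENNReal.ofReal (W.eqm A x) = A.indicator (fun x => lw W x {w | ∀ j, 1 ≤ j → w j ∉ A}) x := by
  unfold SRW.eqm
  by_cases h : x ∈ A
  · rw [if_pos h, indicator_of_mem h, ENNReal.ofReal_toReal (measure_ne_top _ _),
      lw_apply W x (measurableSet_avoid _ _)]
    apply measure_congr
    filter_upwards [good_ae W x] with ω hω
    apply propext
    exact hitTilde_top hω A
  · rw [if_neg h, indicator_of_notMem h, ENNReal.ofReal_zero]

lemma eqm_nonneg (A : Set (Zd d)) (x : Zd d) : 0 ≤ W.eqm A x := by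
  unfold SRW.eqm; split_ifs <;> simp

lemma cap_nonneg (A : Set (Zd d)) : 0 ≤ W.cap A := finsum_nonneg fun x => eqm_nonneg A x

lemma cap_eq (A : Set (Zd d)) (hA : A.Finite) :
    ENNReal.ofReal (W.cap A) = ∑' x, ENNReal.ofReal (W.eqm A x) := by
  have hz : ∀ x ∉ hA.toFinset, W.eqm A x = 0 := by
    intro x hx
    unfold SRW.eqm
    rw [if_neg (by simpa using hx)]
  unfold SRW.cap
  rw [finsum_eq_sum_of_support_subset (s := hA.toFinset), tsum_eq_sum (s := hA.toFinset),
    ENNReal.ofReal_sum_of_nonneg fun x _ => eqm_nonneg A x]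
  · intro x hx; rw [hz x hx]; simp
  · intro x hx
    by_contra hc
    exact hx (hz x hc)

lemma intBox_finite (a b : ℤ) : (intBox a b : Set (Zd d)).Finite := by
  have : (intBox a b : Set (Zd d)) = Set.pi univ fun _ => Ico a b := by
    ext y; simp [intBox]
  rw [this]
  exact Set.Finite.pi' (fun _ => finite_Ico a b) |>.subset fun y hy i => hy i (mem_univ _)

lemma sweep' (D E : Set (Zd d)) (hDE : D ⊆ E) (hE : E.Finite) :
    ∑' x, ENNReal.ofReal (W.eqm E x) * lw W x (ev D univ) ≤ ENNReal.ofReal (W.cap D) := by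
  rw [cap_eq D (hE.subset hDE)]
  simp_rw [eqm_eq]
  rw [← tsum_subtype D (fun y => lw W y {w | ∀ j, 1 ≤ j → w j ∉ D})]
  refine le_trans (le_of_eq ?_) (sweep W D E hDE)
  rw [tsum_subtype E (fun x => lw W x {w | ∀ j, 1 ≤ j → w j ∉ E} * lw W x (ev D univ))]
  congr 1; ext x
  by_cases h : x ∈ E <;> simp [h]

end helper
end Disconnection

/-- (4.28) of Proposition 4.1: with `D = D₀`,
`U = ℤ^d ∩ [−KL+1,KL−1)^d`, `Ď = ℤ^d ∩ [−4L,5L)^d` and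
`p = inf_{x∈∂U} P_x[H_D = ∞]`, whenever `e^λ (1−p) < 1` one has
`E_{ē_Ď}[e^{λ N_{D,U}}] ≤ 1 + (cap(D)/cap(Ď))·(e^λ − 1)/(1 − e^λ (1−p))`. -/
theorem statement14 {d : ℕ} (hd : 3 ≤ d) {Ω : Type*} [MeasurableSpace Ω] (W : SRW d Ω)
    (L K : ℕ) (hL : 1 ≤ L) (hK : 100 ≤ K)
    (D₀ : Set (Zd d)) (hbox : isBox D₀)
    (h1 : (intBox 0 (L : ℤ) : Set (Zd d)) ⊆ D₀) (h2 : D₀ ⊆ intBox (-(3 * L : ℤ)) (4 * L))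
    (lam : ℝ) (hlam : 0 < lam)
    (hcond : Real.exp lam *
        (1 - sInf ((fun x => (W.P x {ω | W.hit D₀ ω = ⊤}).toReal) ''
          bdry (intBox (-((K : ℤ) * L) + 1) ((K : ℤ) * L - 1) : Set (Zd d)))) < 1) :
    ∫⁻ ω, ENNReal.ofReal
        (Real.exp (lam *
          (W.Nexc D₀ (intBox (-((K : ℤ) * L) + 1) ((K : ℤ) * L - 1)) ω : ℝ)))
        ∂ W.Pinit (W.ebar (intBox (-(4 * L : ℤ)) (5 * L)))
      ≤ ENNReal.ofReal
          (1 + W.cap D₀ / W.cap (intBox (-(4 * L : ℤ)) (5 * L)) *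
            ((Real.exp lam - 1) /
              (1 - Real.exp lam *
                (1 - sInf ((fun x => (W.P x {ω | W.hit D₀ ω = ⊤}).toReal) ''
                  bdry (intBox (-((K : ℤ) * L) + 1) ((K : ℤ) * L - 1) : Set (Zd d))))))) := by
  set D := D₀ with hD
  set U : Set (Zd d) := intBox (-((K : ℤ) * L) + 1) ((K : ℤ) * L - 1) with hU
  set E : Set (Zd d) := intBox (-(4 * L : ℤ)) (5 * L) with hE
  set p := sInf ((fun x => (W.P x {ω | W.hit D ω = ⊤}).toReal) '' bdry U) with hp
  have hbdd : BddBelow ((fun x => (W.P x {ω | W.hit D ω = ⊤}).toReal) '' bdry U) :=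
    ⟨0, by rintro _ ⟨x, _, rfl⟩; exact ENNReal.toReal_nonneg⟩
  have hple : ∀ z ∈ bdry U, p ≤ (W.P z {ω | W.hit D ω = ⊤}).toReal :=
    fun z hz => csInf_le hbdd ⟨z, hz, rfl⟩
  have hp1 : p ≤ 1 := by
    rcases (bdry U).eq_empty_or_nonempty with h | ⟨z, hz⟩
    · rw [hp, h]; simp
    · refine (hple z hz).trans ?_
      exact ENNReal.toReal_le_of_le_ofReal zero_le_one (by simpa using prob_le_one)
  have hq : ∀ z ∈ bdry U, lw W z (ev D univ) ≤ ENNReal.ofReal (1 - p) := by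
    intro z hz
    rw [lw_hit]
    exact ENNReal.ofReal_le_ofReal (by linarith [hple z hz])
  have hL' : (1 : ℤ) ≤ L := by exact_mod_cast hL
  have hKL : (100 : ℤ) * L ≤ K * L := by
    have : (100 : ℤ) ≤ K := by exact_mod_cast hK
    exact mul_le_mul_of_nonneg_right this (by linarith)
  have hDU : D ⊆ U := fun y hy i => by
    have := h2 hy i
    constructor <;> linarith
  have hDE : D ⊆ E := fun y hy i => by
    have := h2 hy i
    constructor <;> linarith
  have hEf : E.Finite := intBox_finite _ _
  have hr : 1 < Real.exp lam := Real.one_lt_exp_iff.2 hlam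
  set κ := (Real.exp lam - 1) / (1 - Real.exp lam * (1 - p)) with hκ
  have hκ0 : 0 ≤ κ := div_nonneg (by linarith) (by linarith)
  unfold SRW.Pinit
  rw [lintegral_sum_measure]
  simp_rw [lintegral_smul_measure, smul_eq_mul]
  rcases (cap_nonneg (W := W) E).eq_or_lt with h0 | h0
  · simp [SRW.ebar, ← h0]
  have heb : ∀ x, ENNReal.ofReal (W.ebar E x)
      = (ENNReal.ofReal (W.cap E))⁻¹ * ENNReal.ofReal (W.eqm E x) := by
    intro x
    rw [SRW.ebar, ENNReal.ofReal_div_of_pos h0, ENNReal.div_eq_inv_mul]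
  have hC0 : ENNReal.ofReal (W.cap E) ≠ 0 := by simpa using h0
  calc _ ≤ ∑' x, ((ENNReal.ofReal (W.cap E))⁻¹ * ENNReal.ofReal (W.eqm E x)) *
        (1 + ENNReal.ofReal κ * lw W x (ev D univ)) := by
        refine ENNReal.tsum_le_tsum fun x => ?_
        rw [heb]
        gcongr
        exact exp_bound x D U hDU lam hlam (1 - p) (by linarith) hcond hq
    _ = (ENNReal.ofReal (W.cap E))⁻¹ * (∑' x, ENNReal.ofReal (W.eqm E x)) +
        ENNReal.ofReal κ * ((ENNReal.ofReal (W.cap E))⁻¹ *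
          ∑' x, ENNReal.ofReal (W.eqm E x) * lw W x (ev D univ)) := by
        simp_rw [← ENNReal.tsum_mul_left]
        rw [← ENNReal.tsum_add]
        congr 1; ext x
        ring
    _ ≤ 1 + ENNReal.ofReal κ * ((ENNReal.ofReal (W.cap E))⁻¹ * ENNReal.ofReal (W.cap D)) := by
        rw [← cap_eq E hEf, ENNReal.inv_mul_cancel hC0 ENNReal.ofReal_ne_top]
        gcongr
        exact sweep' D E hDE hEf
    _ = _ := by
        have hdiv : 0 ≤ W.cap D / W.cap E := div_nonneg (cap_nonneg D) h0.le
        rw [ENNReal.ofReal_add zero_le_one (mul_nonneg hdiv hκ0), ENNReal.ofReal_one,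
          ENNReal.ofReal_mul hdiv, ENNReal.ofReal_div_of_pos h0, ENNReal.div_eq_inv_mul, mul_comm]
end

section
/- There is a constant c > 0 depending only on d ≥ 3 such that: for all integers L ≥ 1 and K ≥ c, every finite connected U ⊇ B(0,KL) and every z ∈ ∂U, the function h(x) = P_x[X_{T_U} = z] satisfies |h(x) − h(0)| ≤ c·(|x|/(KL))·h(0) for every x ∈ B(0,2L) ∪ ∂B(0,2L), where |x| denotes the Euclidean norm of x. -/
open MeasureTheory ENNReal Set
open scoped Classical NNReal

open Disconnection

namespace Disc15

abbrev Dir (d : ℕ) := Fin d × Bool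

/-- unit vectors -/
def v {d : ℕ} (e : Dir d) : Zd d := Pi.single e.1 (if e.2 then 1 else -1)

def ng {d : ℕ} (e : Dir d) : Dir d := (e.1, !e.2)

def ngE (d : ℕ) : Dir d ≃ Dir d where
  toFun := ng
  invFun := ng
  left_inv e := by simp [ng]
  right_inv e := by simp [ng]

lemma v_ng {d : ℕ} (e : Dir d) : v (ng e) = - v e := by
  obtain ⟨i, b⟩ := e
  cases b <;> simp [v, ng, ← Pi.single_neg]

def Harm {d : ℕ} (u : Zd d → ℝ) (x : Zd d) : Prop :=
  ∑ e : Dir d, u (x + v e) = (2 * d : ℝ) * u x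

noncomputable def rr {d : ℕ} (u : Zd d → ℝ) (x : Zd d) (e : Dir d) : ℝ :=
  √(u (x + v e)) / √(u x)

noncomputable def FF {d : ℕ} (u : Zd d → ℝ) (x : Zd d) : ℝ := ∑ e, (1 - rr u x e)

lemma card_sum {d : ℕ} (c : ℝ) : ∑ _e : Dir d, c = 2 * d * c := by
  simp only [Finset.sum_const, Finset.card_univ, Fintype.card_prod, Fintype.card_fin,
    Fintype.card_bool, nsmul_eq_mul]
  push_cast; ring

section
variable {d : ℕ} {u : Zd d → ℝ}

lemma rr_pos (hu : ∀ x, 0 < u x) (x e) : 0 < rr u x e :=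
  div_pos (Real.sqrt_pos.2 (hu _)) (Real.sqrt_pos.2 (hu _))

lemma rr_sq (hu : ∀ x, 0 < u x) (x e) : rr u x e ^ 2 = u (x + v e) / u x := by
  rw [rr, div_pow, Real.sq_sqrt (hu _).le, Real.sq_sqrt (hu _).le]

lemma sum_rr_sq (hu : ∀ x, 0 < u x) {x} (hx : Harm u x) : ∑ e, rr u x e ^ 2 = 2 * d := by
  simp_rw [rr_sq hu, ← Finset.sum_div]
  rw [hx]; field_simp [(hu x).ne']

lemma two_FF (hu : ∀ x, 0 < u x) {x} (hx : Harm u x) :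
    2 * FF u x = ∑ e, (rr u x e - 1) ^ 2 := by
  have h := sum_rr_sq hu hx
  have : ∀ e, (rr u x e - 1) ^ 2 = rr u x e ^ 2 - 1 + 2 * (1 - rr u x e) := fun e => by ring
  simp_rw [this, Finset.sum_add_distrib, Finset.sum_sub_distrib, ← Finset.mul_sum]
  rw [h, card_sum]; simp [FF]

lemma FF_nonneg (hu : ∀ x, 0 < u x) {x} (hx : Harm u x) : 0 ≤ FF u x := by
  have := two_FF hu hx
  have : 0 ≤ ∑ e, (rr u x e - 1) ^ 2 := Finset.sum_nonneg fun e _ => sq_nonneg _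
  linarith

lemma FF_le (hu : ∀ x, 0 < u x) (x) : FF u x ≤ 2 * d := by
  have : FF u x ≤ ∑ _e : Dir d, (1:ℝ) :=
    Finset.sum_le_sum fun e _ => by linarith [rr_pos hu x e]
  rw [card_sum] at this; linarith

lemma rr_sq_le (hu : ∀ x, 0 < u x) {x} (hx : Harm u x) (e) : rr u x e ^ 2 ≤ 2 * d := by
  rw [← sum_rr_sq hu hx]
  exact Finset.single_le_sum (f := fun e => rr u x e ^ 2) (fun e _ => sq_nonneg _)
    (Finset.mem_univ e)

lemma rr_le (hd : 1 ≤ d) (hu : ∀ x, 0 < u x) {x} (hx : Harm u x) (e) : rr u x e ≤ 2 * d := by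
  have := rr_sq_le hu hx e
  have hd' : (1:ℝ) ≤ d := by exact_mod_cast hd
  nlinarith [rr_pos hu x e]

lemma cs_deficit {ι : Type*} [Fintype ι] (a b : ι → ℝ) (A B n : ℝ) (hA : 0 < A) (hB : 0 < B)
    (ha : ∑ i, a i ^ 2 = n * A ^ 2) (hb : ∑ i, b i ^ 2 = n * B ^ 2) (j : ι) :
    A * B / 2 * (a j / A - b j / B) ^ 2 ≤ n * A * B - ∑ i, a i * b i := by
  have h1 : ∑ i, (a i / A - b i / B) ^ 2 = 2 * n - 2 * (∑ i, a i * b i) / (A * B) := by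
    have : ∀ i, (a i / A - b i / B) ^ 2
        = a i ^ 2 / A ^ 2 + b i ^ 2 / B ^ 2 - 2 / (A * B) * (a i * b i) := by
      intro i; field_simp; ring
    simp_rw [this, Finset.sum_sub_distrib, Finset.sum_add_distrib, ← Finset.sum_div,
      ← Finset.mul_sum, ha, hb]
    field_simp; ring
  have h2 : (a j / A - b j / B) ^ 2 ≤ ∑ i, (a i / A - b i / B) ^ 2 :=
    Finset.single_le_sum (f := fun i => (a i / A - b i / B) ^ 2) (fun e _ => sq_nonneg _)
      (Finset.mem_univ j)
  rw [h1] at h2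
  calc _ ≤ A * B / 2 * (2 * n - 2 * (∑ i, a i * b i) / (A * B)) := by gcongr
    _ = _ := by field_simp

lemma two_sub_le {r s : ℝ} (hr : 0 < r) (hs : 0 < s) : 2 - r - s ≤ 2 * |1 - r * s| := by
  by_cases h : 2 ≤ r + s
  · have := abs_nonneg (1 - r * s); linarith
  · have := le_abs_self (1 - r * s)
    push Not at h
    nlinarith [sq_nonneg (r - s)]

lemma FF_sq_le (hu : ∀ x, 0 < u x) {x} (hx : Harm u x) :
    FF u x ^ 2 ≤ 2 * d * ∑ e, (1 - rr u x e * rr u x (ng e)) ^ 2 := by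
  have h1 : FF u x = ∑ e, (1 - rr u x (ng e)) :=
    ((ngE d).sum_comp (fun e => 1 - rr u x e)).symm
  have h2 : 2 * FF u x ≤ ∑ e, 2 * |1 - rr u x e * rr u x (ng e)| := by
    rw [two_mul]; nth_rw 2 [h1]
    rw [FF, ← Finset.sum_add_distrib]
    refine Finset.sum_le_sum fun e _ => ?_
    have := two_sub_le (rr_pos hu x e) (rr_pos hu x (ng e))
    linarith
  rw [← Finset.mul_sum] at h2
  have h3 := FF_nonneg hu hx
  have h4 := sq_sum_le_card_mul_sum_sq (s := Finset.univ)
    (f := fun e : Dir d => |1 - rr u x e * rr u x (ng e)|)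
  simp only [sq_abs] at h4
  have h5 : ((Finset.univ : Finset (Dir d)).card : ℝ) = 2 * d := by simp; ring
  rw [h5] at h4
  refine le_trans ?_ h4
  exact pow_le_pow_left₀ h3 (by linarith) 2

lemma FF_mul (hu : ∀ x, 0 < u x) (y) : FF u y * u y =
    2 * d * u y - ∑ e, √(u y) * √(u (y + v e)) := by
  have h : u y = √(u y) ^ 2 := (Real.sq_sqrt (hu _).le).symm
  have h0 := Real.sqrt_pos.2 (hu y)
  rw [FF, Finset.sum_sub_distrib, card_sum, sub_mul, mul_one, Finset.sum_mul]
  congr 1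
  refine Finset.sum_congr rfl fun e _ => ?_
  have e1 : √(u (y + v e)) / √(u y) * √(u y) ^ 2 = √(u y) * √(u (y + v e)) := by field_simp
  rwa [← h] at e1

lemma key (hd : 1 ≤ d) (hu : ∀ x, 0 < u x) {x} (hx : Harm u x) (hx' : ∀ e, Harm u (x + v e)) :
    u x * FF u x ^ 2 / (2 * (2 * d) ^ 2) ≤
      ∑ e, FF u (x + v e) * u (x + v e) - 2 * d * (FF u x * u x) := by
  have hd' : (0:ℝ) < d := by exact_mod_cast hd
  have h1 : ∑ e, FF u (x + v e) * u (x + v e) - 2 * d * (FF u x * u x) =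
      ∑ e, (2 * d * √(u x) * √(u (x + v e))
        - ∑ e', √(u (x + v e')) * √(u (x + v e + v e'))) := by
    simp_rw [FF_mul hu, Finset.sum_sub_distrib, ← Finset.mul_sum]
    have hx2 := hx
    rw [Harm] at hx2
    rw [hx2]
    have : ∑ e : Dir d, √(u (x + v e)) * ∑ e', √(u (x + v e + v e')) =
       ∑ e : Dir d, ∑ e', √(u (x + v e')) * √(u (x + v e + v e')) := by
      simp_rw [Finset.mul_sum]
      rw [Finset.sum_comm]
      refine Finset.sum_congr rfl fun e _ => Finset.sum_congr rfl fun e' _ => ?_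
      rw [add_right_comm]
    rw [this]
    ring
  rw [h1]
  have h2 : ∀ e : Dir d, u x / (2 * (2 * d)) * (1 - rr u x e * rr u x (ng e)) ^ 2 ≤
      2 * d * √(u x) * √(u (x + v e))
        - ∑ e', √(u (x + v e')) * √(u (x + v e + v e')) := by
    intro e
    have hA := Real.sqrt_pos.2 (hu x)
    have hB := Real.sqrt_pos.2 (hu (x + v e))
    have := cs_deficit (fun e' => √(u (x + v e')))
      (fun e' => √(u (x + v e + v e'))) (√(u x)) (√(u (x + v e)))
      (2 * d) hA hB
      (by simp_rw [Real.sq_sqrt (hu _).le]; exact hx)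
      (by simp_rw [Real.sq_sqrt (hu _).le]; exact hx' e) (ng e)
    refine le_trans ?_ this
    have e1 : x + v e + v (ng e) = x := by rw [v_ng]; abel
    simp only [e1]
    have hr := rr_pos hu x e
    have hB' : √(u (x + v e)) = √(u x) * rr u x e := by
      rw [rr]; field_simp
    have hC' : √(u (x + v (ng e))) = √(u x) * rr u x (ng e) := by
      rw [rr]; field_simp
    rw [hB', hC']
    have hux : √(u x) ^ 2 = u x := Real.sq_sqrt (hu _).le
    have : √(u x) * (√(u x) * rr u x e) / 2 *
      (√(u x) * rr u x (ng e) / √(u x)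
        - √(u x) / (√(u x) * rr u x e)) ^ 2
        = u x / (2 * rr u x e) * (1 - rr u x e * rr u x (ng e)) ^ 2 := by
      have e2 : u x / (2 * rr u x e) = √(u x) ^ 2 / (2 * rr u x e) := by rw [hux]
      rw [e2]; field_simp; ring
    rw [this]
    have := rr_le hd hu hx e
    have := (hu x).le
    gcongr
  refine le_trans ?_ (Finset.sum_le_sum fun e _ => h2 e)
  rw [← Finset.mul_sum]
  have h3 := FF_sq_le hu hx
  calc _ = u x / (2 * (2 * d) ^ 2) * FF u x ^ 2 := by ring
    _ ≤ u x / (2 * (2 * d) ^ 2) * (2 * d * ∑ e, (1 - rr u x e * rr u x (ng e)) ^ 2) := by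
        have := (hu x).le
        gcongr
    _ = _ := by field_simp

end

section
variable {d : ℕ} {u : Zd d → ℝ}

noncomputable def eta {d : ℕ} (R : ℕ) (x : Zd d) : ℝ := (R:ℝ) ^ 2 - ∑ i, (x i : ℝ) ^ 2

noncomputable def sg (b : Bool) : ℝ := if b then 1 else -1

lemma sg_sq (b : Bool) : sg b ^ 2 = 1 := by cases b <;> simp [sg]

lemma eta_step (R : ℕ) (x : Zd d) (e : Dir d) :
    eta R (x + v e) = eta R x - 2 * sg e.2 * x e.1 - 1 := by
  obtain ⟨i, b⟩ := e
  have h1 : ∑ j, (((x + v (i, b)) j : ℤ) : ℝ) ^ 2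
      = ∑ j, (((x j : ℝ)) ^ 2 + if j = i then 2 * sg b * x i + 1 else 0) := by
    refine Finset.sum_congr rfl fun j _ => ?_
    by_cases hj : j = i
    · subst hj
      cases b <;> simp [v, sg] <;> ring
    · simp [v, hj]
  simp only [eta]
  rw [h1, Finset.sum_add_distrib]
  simp; ring

lemma coord_le {R : ℕ} {x : Zd d} (h : 0 < eta R x) (i) : |(x i : ℝ)| ≤ R := by
  have h1 : (x i : ℝ) ^ 2 ≤ ∑ i, (x i : ℝ) ^ 2 :=
    Finset.single_le_sum (f := fun i => (x i : ℝ) ^ 2) (fun _ _ => sq_nonneg _) (Finset.mem_univ i)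
  rw [eta] at h
  exact abs_le_of_sq_le_sq (by linarith) (by positivity)

lemma coord_le' {R : ℕ} {x : Zd d} (h : 0 < eta R x) (i) : (x i).natAbs ≤ R := by
  have := coord_le h i
  have h2 : |x i| ≤ (R : ℤ) := by exact_mod_cast this
  rw [abs_le] at h2
  omega

noncomputable def C0 (d : ℕ) : ℝ :=
  36 * (2 * d) + 2 * (2 * (2 * d) ^ 2) * (2 * (2 * d) +
    9 * (2 * d) * (4 * (2 * (2 * d) ^ 2) * (2 * d + 1) ^ 2 + 16 * (2 * d) ^ 2))

lemma C0_nonneg (d : ℕ) : 0 ≤ C0 d := by unfold C0; positivity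

lemma ratio_bd {a b : ℝ} (ha : 0 < a) (hb : a / 2 ≤ b) :
    a ^ 2 / b ^ 2 - 1 ≤ -2 * ((b - a) / a) + 16 * ((b - a) / a) ^ 2 * 1 ∨ 2 * a < b := by
  by_cases h : 2 * a < b
  · exact Or.inr h
  left
  have hb0 : 0 < b := by linarith
  set t := (b - a) / a with ht
  have hbt : b = a * (1 + t) := by rw [ht]; field_simp; ring
  have h1 : -1/2 ≤ t := by rw [ht, le_div_iff₀ ha]; linarith
  have h2 : t ≤ 1 := by rw [ht, div_le_iff₀ ha]; linarith
  have h3 : a ^ 2 / b ^ 2 = 1 / (1 + t) ^ 2 := by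
    rw [hbt]; field_simp
  rw [h3, sub_le_iff_le_add, div_le_iff₀ (by nlinarith)]
  have h4 : 1 ≤ 4 * (1 + t) ^ 2 := by nlinarith
  nlinarith [mul_nonneg (sq_nonneg t) (sub_nonneg.2 h4), mul_nonneg (sq_nonneg t) (sub_nonneg.2 h2)]

lemma term_bd {r t k n Q T : ℝ} (hk : 0 < k) (hr : 0 < r) (hrn : r ≤ n) (hT : t ^ 2 ≤ T)
    (hQ : Q = 4 / k * (n + 1) ^ 2 + 16 * n ^ 2) :
    r ^ 2 * (-2 * t + 16 * t ^ 2) ≤ -2 * t + k / 4 * (r - 1) ^ 2 + Q * T := by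
  have h1 : -2 * ((r - 1) * ((r + 1) * t)) ≤ k / 4 * (r - 1) ^ 2 + 4 / k * ((r + 1) * t) ^ 2 := by
    have : k / 4 * (r - 1) ^ 2 + 4 / k * ((r + 1) * t) ^ 2 + 2 * ((r - 1) * ((r + 1) * t))
      = k / 4 * ((r - 1) + 4 / k * ((r + 1) * t)) ^ 2 := by field_simp; ring
    have h0 : 0 ≤ k / 4 * ((r - 1) + 4 / k * ((r + 1) * t)) ^ 2 := by positivity
    linarith
  have h2 : 4 / k * ((r + 1) * t) ^ 2 + 16 * r ^ 2 * t ^ 2 ≤ Q * T := by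
    calc _ = (4 / k * (r + 1) ^ 2 + 16 * r ^ 2) * t ^ 2 := by ring
      _ ≤ Q * T := by rw [hQ]; gcongr
  nlinarith

lemma grad_max (hd : 1 ≤ d) (hu : ∀ x, 0 < u x) {R : ℕ} (hR : 1 ≤ R)
    (hh : ∀ x, (∀ i, (x i).natAbs ≤ R) → Harm u x) : FF u 0 * R ^ 2 ≤ C0 d := by
  have hd' : (1:ℝ) ≤ d := by exact_mod_cast hd
  have hR' : (1:ℝ) ≤ R := by exact_mod_cast hR
  let S : Set (Zd d) := {x | 0 < eta R x}
  have hS : S.Finite := by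
    refine (Set.finite_Icc (fun _ => -(R:ℤ)) (fun _ => (R:ℤ))).subset fun x hx => ?_
    refine ⟨fun i => ?_, fun i => ?_⟩ <;>
    · have := coord_le' (show 0 < eta R x from hx) i
      dsimp only
      omega
  have hH : ∀ x, 0 < eta R x → Harm u x := fun x hx => hh x (coord_le' hx)
  have e0 : eta R (0 : Zd d) = R ^ 2 := by simp [eta]
  have h0 : (0 : Zd d) ∈ S := by show 0 < eta R 0; rw [e0]; positivity
  obtain ⟨x, hxS, hmax⟩ := Set.exists_max_image S (fun x => eta R x ^ 2 * FF u x) hS ⟨0, h0⟩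
  have hxS : 0 < eta R x := hxS
  suffices h : eta R x ^ 2 * FF u x ≤ C0 d * R ^ 2 by
    have h2 := (hmax 0 h0).trans h
    rw [e0] at h2
    have : (R:ℝ)^2 * (FF u 0 * R ^ 2) ≤ R ^ 2 * C0 d := by linarith
    exact le_of_mul_le_mul_left this (by positivity)
  have hx := hH x hxS
  have hF0 := FF_nonneg hu hx
  have hF1 := FF_le hu x
  by_cases hc : eta R x ≤ 6 * R
  · calc eta R x ^ 2 * FF u x ≤ (6 * (R:ℝ)) ^ 2 * (2 * (d:ℝ)) := by gcongr
      _ = 36 * (2 * (d:ℝ)) * (R:ℝ) ^ 2 := by ring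
      _ ≤ _ := by
        gcongr
        rw [C0]
        have : 0 ≤ 2 * (2 * (2 * (d:ℝ)) ^ 2) * (2 * (2 * d) +
          9 * (2 * d) * (4 * (2 * (2 * d) ^ 2) * (2 * d + 1) ^ 2 + 16 * (2 * d) ^ 2)) := by
          positivity
        linarith
  push Not at hc
  rcases hF0.eq_or_lt with hz | hF0
  · rw [← hz, mul_zero]; have := C0_nonneg d; positivity
  set a := eta R x with ha
  set F := FF u x with hF
  have hstep : ∀ e : Dir d, |eta R (x + v e) - a| ≤ 3 * R := by
    intro e
    rw [eta_step]
    have h1 := coord_le hxS e.1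
    have h2 : |sg e.2| = 1 := by cases e.2 <;> simp [sg]
    have h3 : |sg e.2 * x e.1| ≤ R := by rw [abs_mul, h2, one_mul]; exact h1
    rw [abs_le] at h3 ⊢
    constructor <;> linarith [h3.1, h3.2]
  have hnb : ∀ e : Dir d, a / 2 ≤ eta R (x + v e) ∧ eta R (x + v e) ≤ 2 * a := by
    intro e
    have := abs_le.1 (hstep e)
    constructor <;> linarith [this.1, this.2]
  have hpos : ∀ e : Dir d, 0 < eta R (x + v e) := fun e => by linarith [(hnb e).1]
  have hkey := key hd hu hx (fun e => hH _ (hpos e))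
  have hN : ∀ e : Dir d, FF u (x + v e) * u (x + v e) ≤
      F * (a ^ 2 / eta R (x + v e) ^ 2) * u (x + v e) := by
    intro e
    have h1 := hmax (x + v e) (hpos e)
    have h2 := hpos e
    have := (hu (x + v e)).le
    gcongr
    rw [← mul_div_assoc, le_div_iff₀ (by positivity)]
    linarith
  let k : ℝ := 1 / (2 * (2 * d) ^ 2)
  have hk : 0 < k := by positivity
  let t : Dir d → ℝ := fun e => (eta R (x + v e) - a) / a
  have h1 : k * F ≤ ∑ e, rr u x e ^ 2 * (-2 * t e + 16 * t e ^ 2) := by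
    have hux := hu x
    have hsum : ∑ e, FF u (x + v e) * u (x + v e) - 2 * d * (F * u x) ≤
        F * u x * ∑ e, rr u x e ^ 2 * (-2 * t e + 16 * t e ^ 2) := by
      have hx2 := hx
      rw [Harm] at hx2
      have : 2 * d * (F * u x) = ∑ e, F * u (x + v e) := by
        rw [← Finset.mul_sum, hx2]; ring
      rw [this, ← Finset.sum_sub_distrib, Finset.mul_sum]
      refine Finset.sum_le_sum fun e _ => ?_
      have hb := (ratio_bd hxS (hnb e).1).resolve_right (not_lt.2 (hnb e).2)
      rw [rr_sq hu]
      have h3 : F * u x * (u (x + v e) / u x * (-2 * t e + 16 * t e ^ 2)) =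
        F * u (x + v e) * (-2 * t e + 16 * t e ^ 2) := by field_simp
      rw [h3]
      have h4 : F * u (x + v e) * (a ^ 2 / eta R (x + v e) ^ 2 - 1) ≤
          F * u (x + v e) * (-2 * t e + 16 * t e ^ 2) := by
        have := (hu (x + v e)).le
        refine mul_le_mul_of_nonneg_left ?_ (by positivity)
        rw [mul_one] at hb
        exact hb
      linarith [hN e]
    have h5 : (F * u x) * (k * F) ≤ (F * u x) * ∑ e, rr u x e ^ 2 * (-2 * t e + 16 * t e ^ 2) := by
      refine le_trans (le_of_eq ?_) (hkey.trans hsum)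
      simp only [k]; ring
    exact le_of_mul_le_mul_left h5 (by positivity)
  let Q : ℝ := 4 / k * (2 * d + 1) ^ 2 + 16 * (2 * d) ^ 2
  have hT : ∀ e, t e ^ 2 ≤ 9 * R ^ 2 / a ^ 2 := by
    intro e
    simp only [t]
    rw [div_pow]
    gcongr
    have := sq_le_sq' (abs_le.1 (hstep e)).1 (abs_le.1 (hstep e)).2
    linarith
  have h2 : k * F ≤ ∑ e, (-2 * t e + k / 4 * (rr u x e - 1) ^ 2 + Q * (9 * R ^ 2 / a ^ 2)) :=
    h1.trans (Finset.sum_le_sum fun e _ =>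
      term_bd hk (rr_pos hu x e) (rr_le hd hu hx e) (hT e) rfl)
  rw [Finset.sum_add_distrib, Finset.sum_add_distrib, ← Finset.mul_sum, ← Finset.mul_sum,
    ← two_FF hu hx, card_sum] at h2
  have ht : ∑ e, t e = - (2 * d) / a := by
    simp only [t]
    rw [← Finset.sum_div]
    congr 1
    simp_rw [eta_step, ← ha]
    rw [Fintype.sum_prod_type]
    simp [sg]
    ring_nf
  rw [ht, ← hF] at h2
  have ha2 : a ≤ R ^ 2 := by
    rw [ha, eta]
    have : 0 ≤ ∑ i, (x i : ℝ) ^ 2 := Finset.sum_nonneg fun _ _ => sq_nonneg _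
    linarith
  have h3 : k / 2 * F ≤ 2 * (2 * d) / a + 2 * d * (Q * (9 * R ^ 2 / a ^ 2)) := by
    have : -2 * (-(2 * (d:ℝ)) / a) = 2 * (2 * d) / a := by ring
    linarith
  have h4 : a ^ 2 * F ≤ 2 / k * (2 * (2 * d) * a + 9 * (2 * d) * Q * R ^ 2) := by
    calc a ^ 2 * F = a ^ 2 * (2 / k) * (k / 2 * F) := by field_simp
      _ ≤ a ^ 2 * (2 / k) * (2 * (2 * d) / a + 2 * d * (Q * (9 * R ^ 2 / a ^ 2))) := by gcongr
      _ = _ := by field_simp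
  refine h4.trans ?_
  calc 2 / k * (2 * (2 * d) * a + 9 * (2 * d) * Q * R ^ 2)
      ≤ 2 / k * (2 * (2 * d) * R ^ 2 + 9 * (2 * d) * Q * R ^ 2) := by gcongr
    _ = (C0 d - 36 * (2 * d)) * R ^ 2 := by
        simp only [Q, k, C0, div_div_eq_mul_div, div_one]; ring
    _ ≤ _ := by
        gcongr
        linarith

noncomputable def C1 (d : ℕ) : ℝ := (2 * d + 1) * √(2 * C0 d) + 1

lemma C1_pos (d : ℕ) : 0 < C1 d := by unfold C1; positivity

lemma grad0 (hd : 1 ≤ d) (hu : ∀ x, 0 < u x) {R : ℕ} (hR : 1 ≤ R)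
    (hh : ∀ x, (∀ i, (x i).natAbs ≤ R) → Harm u x) (e : Dir d) :
    |u (v e) - u 0| ≤ C1 d / R * u 0 := by
  have hR' : (1:ℝ) ≤ R := by exact_mod_cast hR
  have h0 := hh 0 (by simp)
  have h1 := grad_max hd hu hR hh
  have h2 := two_FF hu h0
  set r := rr u 0 e with hr
  have h3 : (r - 1) ^ 2 ≤ 2 * FF u 0 := by
    rw [h2]
    exact Finset.single_le_sum (f := fun e => (rr u 0 e - 1) ^ 2) (fun e _ => sq_nonneg _)
      (Finset.mem_univ e)
  have h4 : |r - 1| ≤ √(2 * C0 d) / R := by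
    rw [le_div_iff₀ (by positivity)]
    apply Real.le_sqrt_of_sq_le
    rw [mul_pow, sq_abs]
    nlinarith [sq_nonneg (R:ℝ)]
  have h5 := rr_sq hu 0 e
  have hu0 := hu 0
  rw [zero_add] at h5
  have h6 : u (v e) - u 0 = (r - 1) * (r + 1) * u 0 := by
    have : u (v e) = r ^ 2 * u 0 := by rw [h5]; field_simp
    rw [this]; ring
  have h7 := rr_le hd hu h0 e
  have h8 := rr_pos hu 0 e
  rw [h6, abs_mul, abs_mul, abs_of_pos hu0, abs_of_pos (by linarith : 0 < r + 1)]
  gcongr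
  calc |r - 1| * (r + 1) ≤ √(2 * C0 d) / R * (2 * d + 1) := by gcongr
    _ ≤ C1 d / R := by
      rw [C1, div_mul_eq_mul_div]; gcongr; linarith

lemma grad1 (hd : 1 ≤ d) (hu : ∀ x, 0 < u x) {R : ℕ} (hR : 1 ≤ R) (y : Zd d)
    (hh : ∀ x, (∀ i, (x i - y i).natAbs ≤ R) → Harm u x) (e : Dir d) :
    |u (y + v e) - u y| ≤ C1 d / R * u y := by
  have := grad0 (u := fun x => u (y + x)) hd (fun x => hu _) hR (fun x hx => by
    have := hh (y + x) (by simpa using hx)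
    simpa [Harm, add_assoc] using this) e
  simpa using this

/-- chaining along a path -/
lemma chain (hd : 1 ≤ d) (hu : ∀ x, 0 < u x) {R m : ℕ} (hR : 1 ≤ R)
    (hh : ∀ x, (∀ i, (x i).natAbs ≤ R + m) → Harm u x) (n : ℕ) :
    ∀ x : Zd d, (∀ i, (x i).natAbs ≤ m) → ∑ i, (x i).natAbs = n →
      |u x - u 0| ≤ ((1 + C1 d / R) ^ n - 1) * u 0 := by
  have hC := C1_pos d
  have hR' : (1:ℝ) ≤ R := by exact_mod_cast hR
  induction n with
  | zero =>
    intro x _ h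
    have : x = 0 := by
      ext i
      have := (Finset.sum_eq_zero_iff.1 h) i (Finset.mem_univ i)
      simpa using this
    simp [this]
  | succ n ih =>
    intro x hx h
    have : ∃ i, x i ≠ 0 := by
      by_contra hc
      push Not at hc
      simp [hc] at h
    obtain ⟨i, hi⟩ := this
    let e : Dir d := (i, decide (0 < x i))
    let y : Zd d := x - v e
    have hy : ∀ j, (y j).natAbs = if j = i then (x i).natAbs - 1 else (x j).natAbs := by
      intro j
      by_cases hj : j = i
      · subst hj
        by_cases hp : 0 < x j
        · simp [y, v, e, hp]; omega
        · simp [y, v, e, hp]; omega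
      · simp [y, v, e, hj]
    have hym : ∀ j, (y j).natAbs ≤ m := by
      intro j
      rw [hy]
      have := hx j
      split_ifs with hj
      · subst hj; omega
      · exact this
    have hys : ∑ j, (y j).natAbs = n := by
      have h1 : ∑ j, ((y j).natAbs + if j = i then 1 else 0) = ∑ j, (x j).natAbs := by
        refine Finset.sum_congr rfl fun j _ => ?_
        rw [hy]
        split_ifs with hj
        · subst hj; omega
        · rfl
      rw [Finset.sum_add_distrib, h] at h1
      simp at h1
      exact h1
    have h1 := ih y hym hys
    have h2 := grad1 hd hu hR y (fun z hz => hh z fun j => by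
      have := hz j; have := hym j; omega) e
    have hxy : y + v e = x := by simp [y]
    rw [hxy] at h2
    have h3 := (abs_le.1 h1).2
    have hu0 := hu 0
    have h4 : u y ≤ (1 + C1 d / R) ^ n * u 0 := by linarith
    calc |u x - u 0| ≤ |u x - u y| + |u y - u 0| := by
          have := abs_add_le (u x - u y) (u y - u 0); simpa using this
      _ ≤ C1 d / R * ((1 + C1 d / R) ^ n * u 0) + ((1 + C1 d / R) ^ n - 1) * u 0 := by
          refine add_le_add (h2.trans ?_) h1
          gcongr
      _ = _ := by ring

end

section
variable {d : ℕ}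

noncomputable def C2 (d : ℕ) : ℝ := 6 * d * C1 d + 6

lemma final_bd (hd : 1 ≤ d) (h : Zd d → ℝ) (hpos : ∀ x, 0 ≤ h x) (L K : ℕ) (hL : 1 ≤ L)
    (hK : C2 d ≤ K) (hh : ∀ x : Zd d, (∀ i, (x i).natAbs ≤ K * L) → Harm h x)
    (x : Zd d) (hx : ∀ i, (x i).natAbs ≤ 3 * L) :
    |h x - h 0| ≤ C2 d * (eucNorm x / ((K:ℝ) * L)) * h 0 := by
  have hC := C1_pos d
  have hd' : (1:ℝ) ≤ d := by exact_mod_cast hd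
  have hL' : (1:ℝ) ≤ L := by exact_mod_cast hL
  have hK6' : (6:ℝ) ≤ K := by
    have : 0 ≤ 6 * d * C1 d := by positivity
    rw [C2] at hK; linarith
  have hK6 : 6 ≤ K := by exact_mod_cast hK6'
  obtain ⟨k, rfl⟩ : ∃ k, K = k + 3 := ⟨K - 3, by omega⟩
  have hk : 3 ≤ k := by omega
  have hk' : (3:ℝ) ≤ k := by exact_mod_cast hk
  set n := ∑ i, (x i).natAbs with hn
  set θ := C1 d / ((k * L : ℕ) : ℝ) with hθ
  have hθ0 : 0 ≤ θ := by positivity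
  have h1 : ∀ ε : ℝ, 0 < ε → |h x - h 0| ≤ ((1 + θ) ^ n - 1) * (h 0 + ε) := by
    intro ε hε
    have := chain (u := fun x => h x + ε) (R := k * L) (m := 3 * L) hd
      (fun x => by have := hpos x; linarith) (by nlinarith)
      (fun y hy => by
        have h2 := hh y (fun i => by have := hy i; linarith)
        rw [Harm] at h2 ⊢
        rw [Finset.sum_add_distrib, h2, card_sum]; ring) n x hx rfl
    simpa [hθ] using this
  have h2 : |h x - h 0| ≤ ((1 + θ) ^ n - 1) * h 0 := by
    have ht : Filter.Tendsto (fun ε : ℝ => ((1 + θ) ^ n - 1) * (h 0 + ε)) (nhdsWithin 0 (Set.Ioi 0))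
        (nhds (((1 + θ) ^ n - 1) * (h 0 + 0))) := by
      apply Filter.Tendsto.mono_left _ nhdsWithin_le_nhds
      exact Continuous.tendsto (by fun_prop) 0
    rw [add_zero] at ht
    exact ge_of_tendsto ht (by filter_upwards [self_mem_nhdsWithin] with ε hε using h1 ε hε)
  have hn1 : (n:ℝ) ≤ d * (3 * L) := by
    have : n ≤ ∑ _i : Fin d, 3 * L := Finset.sum_le_sum fun i _ => hx i
    simp at this
    exact_mod_cast this
  have hn2 : (n:ℝ) ≤ d * eucNorm x := by
    rw [hn]; push_cast
    have : ∑ i, |(x i:ℝ)| ≤ ∑ _i : Fin d, eucNorm x := by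
      refine Finset.sum_le_sum fun i _ => ?_
      rw [eucNorm]
      apply Real.le_sqrt_of_sq_le
      rw [sq_abs]
      exact Finset.single_le_sum (f := fun i => (x i : ℝ) ^ 2) (fun _ _ => sq_nonneg _)
        (Finset.mem_univ i)
    simpa [Nat.cast_natAbs] using this
  have hθ2 : θ ≤ 2 * C1 d / (((k + 3 : ℕ) : ℝ) * L) := by
    rw [hθ]; push_cast
    rw [div_le_div_iff₀ (by positivity) (by positivity)]
    have : (k + 3 : ℝ) ≤ 2 * k := by linarith
    calc C1 d * ((k + 3) * L) ≤ C1 d * (2 * k * L) := by gcongr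
      _ = _ := by ring
  have hs : n * θ ≤ 1 := by
    calc n * θ ≤ d * (3 * L) * (2 * C1 d / (((k + 3 : ℕ) : ℝ) * L)) := by gcongr
      _ = 6 * d * C1 d / ((k + 3 : ℕ) : ℝ) := by
        have : (0:ℝ) < ((k + 3 : ℕ) : ℝ) := by positivity
        field_simp; ring
      _ ≤ 1 := by
        rw [div_le_one (by positivity)]
        rw [C2] at hK; linarith
  have hs0 : 0 ≤ n * θ := by positivity
  have hexp : (1 + θ) ^ n - 1 ≤ 2 * (n * θ) := by
    have e1 : (1 + θ) ^ n ≤ Real.exp (n * θ) := by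
      rw [Real.exp_nat_mul]
      gcongr
      linarith [Real.add_one_le_exp θ]
    have e2 := Real.abs_exp_sub_one_le (x := n * θ) (by rw [abs_of_nonneg hs0]; exact hs)
    rw [abs_of_nonneg hs0] at e2
    linarith [le_abs_self (Real.exp (n * θ) - 1)]
  refine h2.trans ?_
  refine mul_le_mul_of_nonneg_right (hexp.trans ?_) (hpos 0)
  have hE : 0 ≤ eucNorm x := Real.sqrt_nonneg _
  calc 2 * (n * θ) ≤ 2 * (d * eucNorm x * (2 * C1 d / (((k + 3 : ℕ) : ℝ) * L))) := by gcongr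
    _ = (4 * d * C1 d) * (eucNorm x / (((k + 3 : ℕ) : ℝ) * L)) := by ring
    _ ≤ _ := by
      gcongr
      rw [C2]; nlinarith [mul_nonneg (by positivity : (0:ℝ) ≤ d) hC.le]

end

section
variable {d : ℕ} {Ω : Type*} [MeasurableSpace Ω]

def Hits (U : Set (Zd d)) (z : Zd d) (y : ℕ → Zd d) (n : ℕ) : Prop :=
  (∀ k < n, y k ∈ U) ∧ y n = z

lemma path_iff (W : SRW d Ω) (U : Set (Zd d)) (z : Zd d) (hz : z ∉ U) (ω : Ω)
    (hζ : ∀ k, 0 < W.ζ k ω) :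
    W.Xat (W.exit U) ω = z ↔ ∃ n, Hits U z (fun k => W.Y k ω) n := by
  have hS : StrictMono fun n => W.S n ω :=
    strictMono_nat_of_lt_succ fun n => by
      simp only [SRW.S, Finset.sum_range_succ]; linarith [hζ n]
  have hS0 : W.S 0 ω = 0 := by simp [SRW.S]
  have J1 : ∀ n t, W.S n ω ≤ t → t < W.S (n + 1) ω → W.jumpIdx t ω = n := by
    intro n t h1 h2
    have : {k : ℕ | W.S k ω ≤ t} = Set.Iic n := by
      ext k
      simp only [Set.mem_ofPred_eq, Set.mem_Iic]
      constructor
      · intro h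
        by_contra hc
        have := hS.monotone (show n + 1 ≤ k by omega)
        linarith
      · intro h
        exact (hS.monotone h).trans h1
    rw [SRW.jumpIdx, this, csSup_Iic]
  by_cases hex : ∃ n, W.Y n ω ∉ U
  · let N := Nat.find hex
    have hN : W.Y N ω ∉ U := Nat.find_spec hex
    have hNmin : ∀ k < N, W.Y k ω ∈ U := fun k hk => by
      have := Nat.find_min hex hk
      push Not at this; exact this
    have hSN0 : 0 ≤ W.S N ω := by rw [← hS0]; exact hS.monotone (Nat.zero_le N)
    have hXN : W.X (W.S N ω) ω = W.Y N ω := by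
      rw [SRW.X, J1 N _ le_rfl (hS (Nat.lt_succ_self N))]
    have hexit : W.exit U ω = ENNReal.ofReal (W.S N ω) := by
      apply IsLeast.csInf_eq
      constructor
      · refine ⟨(W.S N ω).toNNReal, rfl, bot_le, ?_⟩
        rw [Real.coe_toNNReal _ hSN0, hXN]; exact hN
      · rintro _ ⟨s, rfl, -, hs⟩
        by_contra hc
        push Not at hc
        have hlt : (s : ℝ) < W.S N ω := by
          rw [← ENNReal.ofReal_coe_nnreal] at hc
          exact (ENNReal.ofReal_lt_ofReal_iff' .. |>.1 hc).1
        have hex2 : ∃ m, (s:ℝ) < W.S m ω := ⟨N, hlt⟩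
        have hm := Nat.find_spec hex2
        have hmN : Nat.find hex2 ≤ N := Nat.find_min' hex2 hlt
        have hm0 : Nat.find hex2 ≠ 0 := by
          intro h0
          rw [h0, hS0] at hm
          exact absurd hm (not_lt.2 s.2)
        obtain ⟨m, hm'⟩ := Nat.exists_eq_succ_of_ne_zero hm0
        have hle : W.S m ω ≤ s := not_lt.1 (Nat.find_min hex2 (by omega : m < Nat.find hex2))
        rw [hm'] at hm
        have : W.X s ω = W.Y m ω := by rw [SRW.X, J1 m _ hle hm]
        rw [this] at hs
        exact hs (hNmin m (by omega))
    have hX : W.Xat (W.exit U) ω = W.Y N ω := by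
      rw [SRW.Xat, hexit, ENNReal.toReal_ofReal hSN0, hXN]
    rw [hX]
    constructor
    · intro h; exact ⟨N, hNmin, h⟩
    · rintro ⟨n, h1, h2⟩
      have h3 : N ≤ n := Nat.find_min' hex (by simp only at h2; rw [h2]; exact hz)
      have h4 : ¬ N < n := fun h => hN (h1 N h)
      have : n = N := by omega
      rw [← this]; exact h2
  · push Not at hex
    constructor
    · intro h
      exact absurd (hex _) (by rw [SRW.Xat, SRW.X] at h; rw [h]; exact hz)
    · rintro ⟨n, -, h⟩
      exact absurd (hex n) (by simp only at h; rw [h]; exact hz)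

def good (U : Set (Zd d)) (z : Zd d) : (n : ℕ) → Zd d → (Fin n → Zd d) → Prop
  | 0, x, _ => x = z
  | n + 1, x, s => x ∈ U ∧ good U z n (x + s 0) (Fin.tail s)

lemma hits_iff (U : Set (Zd d)) (z : Zd d) (n : ℕ) : ∀ y : ℕ → Zd d,
    Hits U z y n ↔ good U z n (y 0) (fun i => y (i + 1) - y i) := by
  induction n with
  | zero => intro y; simp [Hits, good]
  | succ n ih =>
    intro y
    have := ih (fun k => y (k + 1))
    rw [good]
    have e1 : y 0 + (fun i : Fin (n+1) => y (i + 1) - y i) 0 = y (0 + 1) := by simp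
    have e2 : Fin.tail (fun i : Fin (n+1) => y (i + 1) - y i)
      = fun i : Fin n => y (i + 1 + 1) - y (i + 1) := by
      ext i; simp [Fin.tail]
    rw [e1, e2, ← this]
    simp only [Hits]
    constructor
    · rintro ⟨h1, h2⟩
      exact ⟨h1 0 (by omega), fun k hk => h1 (k + 1) (by omega), h2⟩
    · rintro ⟨h1, h2, h3⟩
      refine ⟨fun k hk => ?_, h3⟩
      cases k with
      | zero => exact h1
      | succ k => exact h2 k (by omega)

noncomputable def qn (U : Set (Zd d)) (z : Zd d) (n : ℕ) (x : Zd d) : ℝ≥0∞ :=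
  ∑' s : Fin n → Zd d, if good U z n x s then ∏ i, stepP d (s i) else 0

lemma qn_succ (U : Set (Zd d)) (z : Zd d) (n : ℕ) {x : Zd d} (hx : x ∈ U) :
    qn U z (n + 1) x = ∑' s, stepP d s * qn U z n (x + s) := by
  rw [qn, ← (Fin.consEquiv (fun _ : Fin (n + 1) => Zd d)).tsum_eq, ENNReal.tsum_prod']
  refine tsum_congr fun s => ?_
  rw [qn, ← ENNReal.tsum_mul_left]
  refine tsum_congr fun t => ?_
  simp only [Fin.consEquiv, Equiv.coe_fn_mk, good, Fin.cons_zero, Fin.tail_cons, hx, true_and,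
    Fin.prod_univ_succ, Fin.cons_succ]
  split_ifs <;> simp

lemma v_inj : Function.Injective (v (d := d)) := by
  rintro ⟨i, b⟩ ⟨j, c⟩ h
  have h1 := congrFun h i
  by_cases hij : i = j
  · subst hij
    cases b <;> cases c <;> simp [v] at h1 ⊢
  · cases b <;> simp [v, hij] at h1

lemma sum_natAbs_v (e : Dir d) : ∑ i, (v e i).natAbs = 1 := by
  obtain ⟨i, b⟩ := e
  rw [Finset.sum_eq_single i]
  · cases b <;> simp [v]
  · intro j _ hj; simp [v, hj]
  · simp

lemma exists_v {s : Zd d} (h : ∑ i, (s i).natAbs = 1) : ∃ e, v e = s := by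
  have : ∃ i, s i ≠ 0 := by
    by_contra hc
    push Not at hc
    simp [hc] at h
  obtain ⟨i, hi⟩ := this
  rw [← Finset.add_sum_erase _ _ (Finset.mem_univ i)] at h
  have h1 : (s i).natAbs = 1 := by omega
  have h2 : ∑ j ∈ Finset.univ.erase i, (s j).natAbs = 0 := by omega
  refine ⟨(i, decide (0 < s i)), ?_⟩
  ext j
  by_cases hj : j = i
  · subst hj
    by_cases hp : 0 < s j
    · simp [v, hp]; omega
    · simp [v, hp]; omega
  · have := Finset.sum_eq_zero_iff.1 h2 j (by simp [hj])
    simp [v, hj]; omega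

lemma tsum_step (g : Zd d → ℝ≥0∞) :
    ∑' s, stepP d s * g s = ∑ e : Dir d, ((2 * d : ℕ) : ℝ≥0∞)⁻¹ * g (v e) := by
  rw [← v_inj.tsum_eq (f := fun s => stepP d s * g s), tsum_fintype]
  · refine Finset.sum_congr rfl fun e _ => ?_
    rw [stepP, if_pos (sum_natAbs_v e)]
  · intro s hs
    by_contra hc
    apply hs
    have : ¬ ∑ i, (s i).natAbs = 1 := fun h => hc (exists_v h)
    simp [stepP, this]

lemma exp_univ : Disconnection.expMeasure Set.univ = 1 := by
  rw [Disconnection.expMeasure, withDensity_apply _ MeasurableSet.univ, Measure.restrict_univ]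
  have : (fun t : ℝ => ENNReal.ofReal (if 0 < t then Real.exp (-t) else 0))
      = (Set.Ioi (0:ℝ)).indicator (fun t => ENNReal.ofReal (Real.exp (-t))) := by
    ext t
    by_cases h : 0 < t <;> simp [h]
  rw [this, lintegral_indicator measurableSet_Ioi, ← ofReal_integral_eq_lintegral_ofReal]
  · rw [integral_exp_neg_Ioi_zero]; simp
  · exact integrableOn_exp_neg_Ioi 0
  · exact Filter.Eventually.of_forall fun t => (Real.exp_pos _).le

lemma exp_neg : Disconnection.expMeasure (Set.Iic 0) = 0 := by
  rw [Disconnection.expMeasure, withDensity_apply _ measurableSet_Iic,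
    setLIntegral_congr_fun (g := fun _ => 0) measurableSet_Iic]
  · simp
  · intro t ht
    simp [not_lt.2 (Set.mem_Iic.1 ht)]

lemma law_incr (W : SRW d Ω) (x : Zd d) (n : ℕ) (s : Fin n → Zd d) :
    W.P x {ω | (fun i : Fin n => W.Y (i + 1) ω - W.Y i ω) = s} = ∏ i, stepP d (s i) := by
  have := W.law x n s (fun _ => Set.univ) (fun _ => MeasurableSet.univ)
  simp only [exp_univ, Finset.prod_const_one, mul_one, Set.mem_univ, implies_true, and_true] at this
  rw [← this]
  congr 1; ext ω; simp [funext_iff]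

lemma zeta_pos (W : SRW d Ω) (x : Zd d) : ∀ᵐ ω ∂ W.P x, ∀ k, 0 < W.ζ k ω := by
  rw [ae_all_iff]
  intro k
  rw [ae_iff]
  have hsub : {ω | ¬ 0 < W.ζ k ω} ⊆ ⋃ s : Fin (k + 1) → Zd d,
      {ω | (∀ i : Fin (k+1), W.Y ((i : ℕ) + 1) ω - W.Y (i : ℕ) ω = s i) ∧
        (∀ i : Fin (k+1), W.ζ (i : ℕ) ω ∈ (if i = Fin.last k then Set.Iic 0 else Set.univ : Set ℝ))} := by
    intro ω hω
    rw [Set.mem_iUnion]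
    refine ⟨fun i => W.Y ((i : ℕ) + 1) ω - W.Y (i : ℕ) ω, fun i => rfl, fun i => ?_⟩
    split_ifs with h
    · subst h; simpa using hω
    · trivial
  refine measure_mono_null hsub (measure_iUnion_null fun s => ?_)
  rw [W.law x (k + 1) s _ (fun i => by split_ifs <;> measurability)]
  have h0 : ∏ i : Fin (k + 1), Disconnection.expMeasure
      (if i = Fin.last k then Set.Iic 0 else Set.univ : Set ℝ) = 0 :=
    Finset.prod_eq_zero (i := Fin.last k) (Finset.mem_univ _) (by simp [exp_neg])
  rw [h0, mul_zero]

lemma Y_zero_ae (W : SRW d Ω) (x : Zd d) : ∀ᵐ ω ∂ W.P x, W.Y 0 ω = x := by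
  have := W.isProb x
  have hm : MeasurableSet {ω | W.Y 0 ω = x} := W.measurable_Y 0 (measurableSet_singleton x)
  exact (mem_ae_iff_prob_eq_one hm).2 (W.Y_zero x)

lemma meas_incr (W : SRW d Ω) (n : ℕ) :
    Measurable (fun ω => (fun i : Fin n => W.Y (i + 1) ω - W.Y i ω)) :=
  measurable_pi_lambda _ fun i => (W.measurable_Y _).sub (W.measurable_Y _)

lemma prob_good (W : SRW d Ω) (U : Set (Zd d)) (z : Zd d) (n : ℕ) (x : Zd d) :
    W.P x {ω | good U z n x (fun i => W.Y (i + 1) ω - W.Y i ω)} = qn U z n x := by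
  have h := Measure.map_apply (μ := W.P x) (meas_incr W n)
    (s := {s | good U z n x s}) (Set.to_countable _).measurableSet
  have e : {ω | good U z n x (fun i => W.Y (i + 1) ω - W.Y i ω)} =
    (fun ω => (fun i : Fin n => W.Y (i + 1) ω - W.Y i ω)) ⁻¹' {s | good U z n x s} := rfl
  rw [e, ← h, ← Measure.tsum_indicator_apply_singleton _ _ (Set.to_countable _).measurableSet, qn]
  refine tsum_congr fun s => ?_
  rw [Set.indicator_apply]
  simp only [Set.mem_ofPred_eq]
  split_ifs
  · rw [Measure.map_apply (meas_incr W n) (measurableSet_singleton s), ← law_incr W x n s]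
    rfl
  · rfl

noncomputable def qq (U : Set (Zd d)) (z : Zd d) (x : Zd d) : ℝ≥0∞ := ∑' n, qn U z n x

lemma prob_hits (W : SRW d Ω) (U : Set (Zd d)) (z : Zd d) (hz : z ∉ U) (x : Zd d) :
    W.P x {ω | ∃ n, Hits U z (fun k => W.Y k ω) n} = qq U z x := by
  have e : {ω | ∃ n, Hits U z (fun k => W.Y k ω) n}
    = ⋃ n, {ω | Hits U z (fun k => W.Y k ω) n} := by ext; simp
  rw [e, measure_iUnion, qq]
  · refine tsum_congr fun n => ?_
    rw [← prob_good W]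
    apply measure_congr
    filter_upwards [Y_zero_ae W x] with ω hω
    apply propext
    show Hits U z (fun k => W.Y k ω) n ↔ good U z n x (fun i => W.Y (i + 1) ω - W.Y i ω)
    rw [hits_iff, hω]
  · intro n m hnm
    rw [Function.onFun, Set.disjoint_left]
    rintro ω ⟨h1, h2⟩ ⟨h3, h4⟩
    rcases lt_or_gt_of_ne hnm with h | h
    · exact hz (h2 ▸ h3 n h)
    · exact hz (h4 ▸ h1 m h)
  · intro n
    have : {ω | Hits U z (fun k => W.Y k ω) n} =
      (⋂ k, ⋂ (_ : k < n), (W.Y k) ⁻¹' U) ∩ (W.Y n) ⁻¹' {z} := by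
      ext; simp [Hits]
    rw [this]
    refine MeasurableSet.inter (MeasurableSet.iInter fun k => MeasurableSet.iInter fun _ => ?_) ?_
    · exact W.measurable_Y k (Set.to_countable _).measurableSet
    · exact W.measurable_Y n (measurableSet_singleton z)

lemma prob_eq (W : SRW d Ω) (U : Set (Zd d)) (z : Zd d) (hz : z ∉ U) (x : Zd d) :
    W.P x {ω | W.Xat (W.exit U) ω = z} = qq U z x := by
  rw [← prob_hits W U z hz]
  apply measure_congr
  filter_upwards [zeta_pos W x] with ω hω
  exact propext (path_iff W U z hz ω hω)

lemma qq_harm (W : SRW d Ω) (hd : 1 ≤ d) (U : Set (Zd d)) (z : Zd d) (hz : z ∉ U) {x : Zd d}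
    (hx : x ∈ U) : Harm (fun x => (qq U z x).toReal) x := by
  have hfin : ∀ y, qq U z y ≠ ⊤ := fun y => by
    have := W.isProb y
    rw [← prob_hits W U z hz]; exact measure_ne_top _ _
  have h0 : qn U z 0 x = 0 := by
    have : x ≠ z := fun h => hz (h ▸ hx)
    simp [qn, good, this]
  have h1 : qq U z x = ∑ e : Dir d, ((2 * d : ℕ) : ℝ≥0∞)⁻¹ * qq U z (x + v e) := by
    rw [← tsum_step (fun s => qq U z (x + s))]
    rw [qq, tsum_eq_zero_add' ENNReal.summable, h0, zero_add]
    simp_rw [qn_succ U z _ hx, qq, ← ENNReal.tsum_mul_left]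
    rw [ENNReal.tsum_comm]
  have hd' : (0:ℝ) < d := by exact_mod_cast hd
  rw [Harm]
  rw [h1, ENNReal.toReal_sum, Finset.mul_sum]
  · refine Finset.sum_congr rfl fun e _ => ?_
    rw [ENNReal.toReal_mul, ENNReal.toReal_inv, ENNReal.toReal_natCast]
    push_cast
    field_simp
  · intro e _
    refine ENNReal.mul_ne_top ?_ (hfin _)
    simp; omega

end

end Disc15

open Disc15

/-- (A.2) in the proof of Lemma 1.3: gradient estimate for the harmonic
function `h(x) = P_x[X_{T_U} = z]`: `|h(x) − h(0)| ≤ c (|x|/(KL)) h(0)` on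
`B(0,2L) ∪ ∂B(0,2L)`. -/
theorem statement15 {d : ℕ} (hd : 3 ≤ d) {Ω : Type*} [MeasurableSpace Ω] (W : SRW d Ω) :
    ∃ c : ℝ, 0 < c ∧
      ∀ (L K : ℕ), 1 ≤ L → c ≤ (K : ℝ) →
        ∀ U : Set (Zd d), U.Finite → connSet U → ball (0 : Zd d) (K * L) ⊆ U →
          ∀ z ∈ bdry U,
            ∀ x ∈ ball (0 : Zd d) (2 * L) ∪ bdry (ball (0 : Zd d) (2 * L)),
              |(W.P x {ω | W.Xat (W.exit U) ω = z}).toReal -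
                  (W.P 0 {ω | W.Xat (W.exit U) ω = z}).toReal|
                ≤ c * (eucNorm x / ((K : ℝ) * L)) *
                    (W.P 0 {ω | W.Xat (W.exit U) ω = z}).toReal := by
  refine ⟨C2 d, by have := C1_pos d; unfold C2; positivity, ?_⟩
  intro L K hL hK U _ _ hU z hz x hx
  have hzU : z ∉ U := hz.1
  simp only [prob_eq W U z hzU]
  have hin : ∀ y : Zd d, ∀ r, (∀ i, (y i).natAbs ≤ r) → y ∈ ball (0 : Zd d) r := by
    intro y r hy
    simp only [ball, supDist, Set.mem_ofPred_eq]
    exact Finset.sup_le fun i _ => by simpa using hy i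
  have hout : ∀ y : Zd d, ∀ r, y ∈ ball (0 : Zd d) r → ∀ i, (y i).natAbs ≤ r := by
    intro y r hy i
    have h : (Finset.univ.sup fun i => ((0 : Zd d) i - y i).natAbs) ≤ r := hy
    have := Finset.sup_le_iff.1 h i (Finset.mem_univ i)
    simpa using this
  refine final_bd (by omega) (fun x => (qq U z x).toReal) (fun _ => ENNReal.toReal_nonneg) L K hL hK
    (fun y hy => qq_harm W (by omega) U z hzU (hU (hin y _ hy))) x ?_
  intro i
  rcases hx with hx | ⟨-, y, hy, hadj⟩
  · have := hout x _ hx i; omega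
  · have h1 := hout y _ hy i
    have h2 : (y i - x i).natAbs ≤ 1 := by
      rw [← show (∑ i, (y i - x i).natAbs) = 1 from hadj]
      exact Finset.single_le_sum (f := fun i => (y i - x i).natAbs) (fun _ _ => Nat.zero_le _)
        (Finset.mem_univ i)
    omega
end
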